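/- Suppose H = ℝ^N, p = 1, α > 0 and β > 0. Assume that the set of minimizers of inf_{μ ∈ M_1(Z)} F(Aμ) + G_{α,β}(μ) is non-empty and weak* compact. Then at least one minimizer is of the form μ_min = Σ_{i=1}^N c_i(δ_{z_i} − δ_{w_i}) + μ_min(Z) δ_e, where c_i ∈ ℝ and z_i, w_i ∈ Z. -/

import Mathlib

open MeasureTheory Filter Topology
open scoped ENNReal NNReal

noncomputable section
attribute [local instance] Classical.propDecidable

variable {Z : Type*} [MetricSpace Z] [MeasurableSpace Z] [BorelSpace Z]

/-- Integral `∫ f dμ` of a function against a finite signed measure, via Jordan decomposition. -/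
def sInteg (μ : SignedMeasure Z) (f : Z → ℝ) : ℝ :=
  (∫ z, f z ∂μ.toJordanDecomposition.posPart) - ∫ z, f z ∂μ.toJordanDecomposition.negPart

/-- Total variation norm `‖μ‖_TV`. -/
def tvNorm (μ : SignedMeasure Z) : ℝ := (μ.totalVariation Set.univ).toReal

/-- The unbalanced Kantorovich–Rubinstein norm
`‖μ‖_KRu = |μ(Z)| + sup { ∫ f dμ : f(e) = 0, Lip(f) ≤ 1 }`. -/
def kruNorm (e : Z) (μ : SignedMeasure Z) : ℝ :=
  |μ Set.univ| +
    sSup {r : ℝ | ∃ f : Z → ℝ, f e = 0 ∧ LipschitzWith 1 f ∧ r = sInteg μ f}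

/-- The balanced Kantorovich–Rubinstein norm `‖μ‖_KR = sup { ∫ f dμ : f(e) = 0, Lip(f) ≤ 1 }`. -/
def krNorm (e : Z) (μ : SignedMeasure Z) : ℝ :=
  sSup {r : ℝ | ∃ f : Z → ℝ, f e = 0 ∧ LipschitzWith 1 f ∧ r = sInteg μ f}

/-- `μ ∈ M_1(Z)`: finite first moment, `∫ d(z,e) d|μ| < ∞`. -/
def MemM1 (e : Z) (μ : SignedMeasure Z) : Prop :=
  (∫⁻ z, ENNReal.ofReal (dist z e) ∂μ.totalVariation) < ⊤

/-- `μ ∈ M_p(Z)`: finite `p`-th moment, `∫ d(z,e)^p d|μ| < ∞`. -/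
def MemMp (e : Z) (p : ℝ) (μ : SignedMeasure Z) : Prop :=
  (∫⁻ z, ENNReal.ofReal (dist z e ^ p) ∂μ.totalVariation) < ⊤

/-- `∫ (1 + d(z,e)^p) d|μ|` as an extended nonnegative real number. -/
def momLint (e : Z) (p : ℝ) (μ : SignedMeasure Z) : ℝ≥0∞ :=
  ∫⁻ z, ENNReal.ofReal (1 + dist z e ^ p) ∂μ.totalVariation

/-- Dirac measure at a point, as a signed measure. -/
def diracSM (x : Z) : SignedMeasure Z := (Measure.dirac x).toSignedMeasure

/-- The regularizer `G_{α,β}(μ) = α‖μ‖_KRu + β ∫ (1 + d(z,e)^p) d|μ|` if `μ ∈ M_p(Z)`,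
and `+∞` otherwise, as an extended real number. -/
def Gab (e : Z) (p α β : ℝ) (μ : SignedMeasure Z) : EReal :=
  if MemMp e p μ then ((α * kruNorm e μ + β * (momLint e p μ).toReal : ℝ) : EReal) else ⊤

/-- A geodesic metric space: any two points are joined by points realizing all
intermediate distance proportions. -/
def IsGeodesic (Z : Type*) [MetricSpace Z] : Prop :=
  ∀ x y : Z, ∀ t : ℝ, 0 ≤ t → t ≤ 1 →
    ∃ z : Z, dist x z = t * dist x y ∧ dist z y = (1 - t) * dist x y

section GenericHelpers

lemma rt_pos_ext {V E : Type*} [AddCommGroup V] [Module ℝ V] [AddCommGroup E] [Module ℝ E]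
    (s : PointedCone ℝ E) (T : V →ₗ[ℝ] E) (L : V →ₗ[ℝ] ℝ)
    (hpos : ∀ v, T v ∈ s → 0 ≤ L v) (hcof : ∀ h : E, ∃ v, T v + h ∈ s) :
    ∃ Λ : E →ₗ[ℝ] ℝ, (∀ v, Λ (T v) = L v) ∧ ∀ h ∈ s, 0 ≤ Λ h := by
  have hker : L ∈ (LinearMap.ker T).dualAnnihilator := by
    rw [Submodule.mem_dualAnnihilator]
    intro w hw
    rw [LinearMap.mem_ker] at hw
    have h1 := hpos w (by rw [hw]; exact s.zero_mem)
    have h2 := hpos (-w) (by rw [map_neg, hw, neg_zero]; exact s.zero_mem)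
    rw [map_neg] at h2
    linarith
  rw [← LinearMap.range_dualMap_eq_dualAnnihilator_ker] at hker
  obtain ⟨Λ0, h0⟩ := hker
  have h0' : ∀ v, Λ0 (T v) = L v := fun v => by rw [← h0]; rfl
  obtain ⟨g, hg1, hg2⟩ := riesz_extension s ⟨LinearMap.range T, Λ0.domRestrict (LinearMap.range T)⟩
    (by
      rintro ⟨x, ⟨v, rfl⟩⟩ hx
      change 0 ≤ Λ0 (T v)
      rw [h0']; exact hpos v hx)
    (by
      intro y
      obtain ⟨v, hv⟩ := hcof y
      exact ⟨⟨T v, ⟨v, rfl⟩⟩, hv⟩)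
  refine ⟨g, fun v => ?_, hg2⟩
  rw [← h0' v]
  exact hg1 ⟨T v, ⟨v, rfl⟩⟩

lemma rt_mean_mem_cone {X : Type*} [MeasurableSpace X] (π : Measure X) (n : ℕ) :
    ∀ (E : Type*) [NormedAddCommGroup E] [NormedSpace ℝ E] [FiniteDimensional ℝ E]
      (C : PointedCone ℝ E) (g : X → E), Module.finrank ℝ E = n → Integrable g π →
      (∀ᵐ x ∂π, g x ∈ C) → ∫ x, g x ∂π ∈ C := by
  induction n using Nat.strong_induction_on with
  | _ n ih =>
  intro E _ _ _ C g hn hg hgC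
  -- reduction to a proper subspace
  have red : ∀ W : Submodule ℝ E, W ≠ ⊤ → (∀ᵐ x ∂π, g x ∈ W) → ∫ x, g x ∂π ∈ C := by
    intro W hW hgW
    obtain ⟨P, hP⟩ := Submodule.ClosedComplemented.of_finiteDimensional (𝕜 := ℝ) W
    have hlt : Module.finrank ℝ W < n := hn ▸ Submodule.finrank_lt hW
    have hae : ∀ᵐ x ∂π, ((P (g x) : W) : E) = g x := by
      filter_upwards [hgW] with x hx
      have := hP ⟨g x, hx⟩
      exact congrArg Subtype.val this
    have := ih _ hlt W (C.comap W.subtype) (fun x => P (g x)) rfl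
      (P.integrable_comp hg) (by
        filter_upwards [hae, hgC] with x hx hx2
        change ((P (g x) : W) : E) ∈ C
        rw [hx]; exact hx2)
    have h2 : ((∫ x, P (g x) ∂π : W) : E) = ∫ x, g x ∂π := by
      have h3 := W.subtypeL.integral_comp_comm (P.integrable_comp hg)
      change W.subtypeL (∫ x, P (g x) ∂π) = _
      rw [← h3]
      exact integral_congr_ae hae
    rw [← h2]; exact this
  have hconv : Convex ℝ (C : Set E) := C.convex
  by_contra hv
  by_cases hint : (interior (C : Set E)).Nonempty
  · obtain ⟨p, hp⟩ := geometric_hahn_banach_open_point hconv.interior isOpen_interior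
      (fun h => hv (interior_subset h))
    have hcl : ∀ c ∈ (C : Set E), p c ≤ p (∫ x, g x ∂π) := by
      intro c hc
      have h1 : c ∈ closure (interior (C : Set E)) := by
        rw [hconv.closure_interior_eq_closure_of_nonempty_interior hint]
        exact subset_closure hc
      have h2 : IsClosed {x | p x ≤ p (∫ x, g x ∂π)} :=
        isClosed_le p.continuous continuous_const
      exact closure_minimal (fun x hx => (hp x hx).le) h2 h1
    have hpv : 0 ≤ p (∫ x, g x ∂π) := by simpa using hcl 0 C.zero_mem
    have hneg : ∀ c ∈ C, p c ≤ 0 := by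
      intro c hc
      by_contra! h
      have h1 := hcl ((p (∫ x, g x ∂π) / p c + 1) • c)
        (C.smul_mem (by positivity) hc)
      rw [map_smul, smul_eq_mul, add_mul, div_mul_cancel₀ _ h.ne'] at h1
      linarith
    have hcomm : ∫ x, p (g x) ∂π = p (∫ x, g x ∂π) := p.integral_comp_comm hg
    have hae0 : ∀ᵐ x ∂π, p (g x) = 0 := by
      have hi : ∫ x, -p (g x) ∂π = 0 := by
        apply le_antisymm
        · rw [integral_neg, hcomm]; linarith
        · apply integral_nonneg_of_ae
          filter_upwards [hgC] with x hx
          simpa using hneg _ hx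
      have := (integral_eq_zero_iff_of_nonneg_ae (by
          filter_upwards [hgC] with x hx
          simpa using hneg _ hx) ((p.integrable_comp hg).neg)).1 hi
      filter_upwards [this] with x hx
      simpa using hx
    refine hv (red (LinearMap.ker (p : E →ₗ[ℝ] ℝ)) ?_ (by
      filter_upwards [hae0] with x hx
      simpa using hx))
    intro htop
    obtain ⟨c, hc⟩ := hint
    have h1 := hp c hc
    have h0 : ∀ x, p x = 0 := fun x => by
      have : x ∈ LinearMap.ker (p : E →ₗ[ℝ] ℝ) := by rw [htop]; trivial
      simpa using this
    rw [h0, h0] at h1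
    exact lt_irrefl _ h1
  · rw [hconv.interior_nonempty_iff_affineSpan_eq_top] at hint
    refine hv (red (Submodule.span ℝ (C : Set E)) ?_ (by
      filter_upwards [hgC] with x hx
      exact Submodule.subset_span hx))
    intro htop
    apply hint
    rw [AffineSubspace.affineSpan_eq_top_iff_vectorSpan_eq_top_of_nonempty ℝ E E
      ⟨0, C.zero_mem⟩]
    rw [eq_top_iff, ← htop, Submodule.span_le]
    intro x hx
    have := vsub_mem_vectorSpan ℝ (s := (C : Set E)) hx (C.zero_mem)
    simpa using this

lemma rt_reduce {ι F : Type*} [AddCommGroup F] [Module ℝ F] [FiniteDimensional ℝ F]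
    (v : ι → F) (cost : ι → ℝ) (hcost : ∀ i, 0 < cost i) (n : ℕ) :
    ∀ (s : Finset ι) (t : ι → ℝ), s.card = n → (∀ i ∈ s, 0 ≤ t i) →
      ∃ (s' : Finset ι) (t' : ι → ℝ), s'.card ≤ Module.finrank ℝ F ∧ (∀ i ∈ s', 0 ≤ t' i) ∧
        ∑ i ∈ s', t' i • v i = ∑ i ∈ s, t i • v i ∧
        ∑ i ∈ s', t' i * cost i ≤ ∑ i ∈ s, t i * cost i := by
  induction n using Nat.strong_induction_on with
  | _ n ih =>
  intro s t hs ht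
  by_cases hle : s.card ≤ Module.finrank ℝ F
  · exact ⟨s, t, hle, ht, rfl, le_rfl⟩
  have hdep : ∃ r : ι → ℝ, ∑ i ∈ s, r i • v i = 0 ∧ ∃ i ∈ s, r i ≠ 0 := by
    have h1 : ¬ LinearIndepOn ℝ v (s : Set ι) := by
      intro h
      have := LinearIndependent.fintype_card_le_finrank h
      simp at this
      exact hle this
    rw [linearIndepOn_finset_iff] at h1
    push Not at h1
    exact h1
  obtain ⟨r, hr0, hr1⟩ : ∃ r : ι → ℝ, ∑ i ∈ s, r i • v i = 0 ∧
      0 ≤ ∑ i ∈ s, r i * cost i ∧ ∃ i ∈ s, 0 < r i := by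
    have key : ∀ r : ι → ℝ, (∃ i ∈ s, r i ≠ 0) → 0 ≤ ∑ i ∈ s, r i * cost i →
        ∃ i ∈ s, 0 < r i := by
      rintro r ⟨i, hi, hri⟩ hsum
      by_contra! hneg
      have : ∑ i ∈ s, r i * cost i < ∑ i ∈ s, (0 : ℝ) := by
        apply Finset.sum_lt_sum
        · intro j hj
          exact mul_nonpos_of_nonpos_of_nonneg (hneg j hj) (hcost j).le
        · exact ⟨i, hi, mul_neg_of_neg_of_pos (lt_of_le_of_ne (hneg i hi) hri) (hcost i)⟩
      simp at this
      linarith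
    obtain ⟨r, h0, h1⟩ := hdep
    rcases le_total 0 (∑ i ∈ s, r i * cost i) with h | h
    · exact ⟨r, h0, h, key r h1 h⟩
    · have h' : 0 ≤ ∑ i ∈ s, (-r) i * cost i := by
        simp only [Pi.neg_apply, neg_mul, Finset.sum_neg_distrib]; linarith
      refine ⟨-r, ?_, h', key _ ?_ h'⟩
      · simp [h0]
      · obtain ⟨i, hi, h2⟩ := h1
        exact ⟨i, hi, by simpa using h2⟩
  obtain ⟨hrc, hrp⟩ := hr1
  have hne : (s.filter (fun i => 0 < r i)).Nonempty := by
    obtain ⟨i, hi, h⟩ := hrp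
    exact ⟨i, by simp [hi, h]⟩
  obtain ⟨j, hj, hjmin⟩ := Finset.exists_min_image _ (fun i => t i / r i) hne
  rw [Finset.mem_filter] at hj
  set ε := t j / r j with hε
  have hε0 : 0 ≤ ε := div_nonneg (ht j hj.1) hj.2.le
  have hεj : t j - ε * r j = 0 := by rw [hε, div_mul_cancel₀ _ hj.2.ne']; ring
  have hnn : ∀ i ∈ s, 0 ≤ t i - ε * r i := by
    intro i hi
    by_cases hri : 0 < r i
    · have := hjmin i (by simp [hi, hri])
      rw [le_div_iff₀ hri] at this
      linarith
    · have : ε * r i ≤ 0 := mul_nonpos_of_nonneg_of_nonpos hε0 (not_lt.1 hri)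
      have := ht i hi
      linarith
  have hcard : (s.erase j).card < n := hs ▸ Finset.card_erase_lt_of_mem hj.1
  obtain ⟨s', t', h1, h2, h3, h4⟩ := ih _ hcard (s.erase j) (fun i => t i - ε * r i) rfl
    (fun i hi => hnn i (Finset.mem_of_mem_erase hi))
  refine ⟨s', t', h1, h2, ?_, ?_⟩
  · rw [h3, Finset.sum_erase _ (by simp [hεj])]
    simp only [sub_smul, Finset.sum_sub_distrib, mul_smul, ← Finset.smul_sum, hr0]
    simp
  · refine h4.trans ?_
    rw [Finset.sum_erase _ (by simp [hεj])]
    simp only [sub_mul, Finset.sum_sub_distrib, mul_assoc, ← Finset.mul_sum]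
    have := mul_nonneg hε0 hrc
    linarith

end GenericHelpers
set_option linter.unusedSectionVars false
set_option linter.style.haveILetI false

section Plan

/-- continuous functions with linear growth -/
def rtU (e : Z) : Submodule ℝ (Z → ℝ) where
  carrier := {u | Continuous u ∧ ∃ C, ∀ z, |u z| ≤ C * (1 + dist z e)}
  zero_mem' := ⟨continuous_const, 0, by simp⟩
  add_mem' := by
    rintro u v ⟨hu, C, hC⟩ ⟨hv, D, hD⟩
    refine ⟨hu.add hv, C + D, fun z => ?_⟩
    have := abs_add_le (u z) (v z)
    have := hC z
    have := hD z
    simp only [Pi.add_apply]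
    linarith
  smul_mem' := by
    rintro c u ⟨hu, C, hC⟩
    refine ⟨hu.const_smul c, |c| * C, fun z => ?_⟩
    simp only [Pi.smul_apply, smul_eq_mul, abs_mul]
    have := mul_le_mul_of_nonneg_left (hC z) (abs_nonneg c)
    linarith

/-- functions on the product with linear growth -/
def rtE (e : Z) : Submodule ℝ (Z × Z → ℝ) where
  carrier := {h | ∃ C, ∀ z, |h z| ≤ C * (1 + dist z.1 e + dist z.2 e)}
  zero_mem' := ⟨0, by simp⟩
  add_mem' := by
    rintro u v ⟨C, hC⟩ ⟨D, hD⟩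
    refine ⟨C + D, fun z => ?_⟩
    have := abs_add_le (u z) (v z)
    have := hC z
    have := hD z
    simp only [Pi.add_apply]
    linarith
  smul_mem' := by
    rintro c u ⟨C, hC⟩
    refine ⟨|c| * C, fun z => ?_⟩
    simp only [Pi.smul_apply, smul_eq_mul, abs_mul]
    have := mul_le_mul_of_nonneg_left (hC z) (abs_nonneg c)
    linarith

lemma rt_growth_integrable {e : Z} {p : Measure Z} [IsFiniteMeasure p]
    (hp : Integrable (fun z => dist z e) p) {u : Z → ℝ} (hu : Continuous u) {C : ℝ}
    (hC : ∀ z, |u z| ≤ C * (1 + dist z e)) : Integrable u p := by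
  refine Integrable.mono' (g := fun z => C * (1 + dist z e))
    (((integrable_const 1).add hp).const_mul C) hu.measurable.aestronglyMeasurable ?_
  exact Eventually.of_forall hC

lemma rt_lip_growth {e : Z} {g : Z → ℝ} {K : ℝ≥0} (hg : LipschitzWith K g) :
    ∀ z, |g z| ≤ (|g e| + K) * (1 + dist z e) := by
  intro z
  have h1 := hg.dist_le_mul z e
  rw [Real.dist_eq] at h1
  have h2 : |g z| ≤ |g z - g e| + |g e| := by
    have := abs_add_le (g z - g e) (g e)
    simpa using this
  have h3 := mul_nonneg (abs_nonneg (g e)) (dist_nonneg (x := z) (y := e))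
  have h4 := K.coe_nonneg
  nlinarith

lemma rt_lip_integrable {e : Z} {p : Measure Z} [IsFiniteMeasure p]
    (hp : Integrable (fun z => dist z e) p) {g : Z → ℝ} {K : ℝ≥0} (hg : LipschitzWith K g) :
    Integrable g p :=
  rt_growth_integrable hp hg.continuous (rt_lip_growth hg)

lemma rt_prod_nonneg {e : Z} {p q : Measure Z} [IsFiniteMeasure p] [IsFiniteMeasure q]
    (hpq : p.real Set.univ = q.real Set.univ) {u v : Z → ℝ}
    (hu : Integrable u p) (hv : Integrable v q) (h : ∀ x y, 0 ≤ u x + v y) :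
    0 ≤ ∫ x, u x ∂p + ∫ y, v y ∂q := by
  haveI : Nonempty Z := ⟨e⟩
  have hb : BddBelow (Set.range u) := ⟨-v e, by rintro _ ⟨x, rfl⟩; have := h x e; linarith⟩
  set c := ⨅ x, u x
  have h1 : ∀ x, c ≤ u x := fun x => ciInf_le hb x
  have h2 : ∀ y, -c ≤ v y := fun y => by
    have : -v y ≤ c := le_ciInf fun x => by have := h x y; linarith
    linarith
  have h3 : ∫ x, c ∂p ≤ ∫ x, u x ∂p := integral_mono (integrable_const _) hu h1
  have h4 : ∫ x, -c ∂q ≤ ∫ x, v x ∂q := integral_mono (integrable_const _) hv h2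
  rw [integral_const, smul_eq_mul] at h3 h4
  rw [hpq] at h3
  linarith

lemma rt_ctransform {e : Z} {u v : Z → ℝ} (h : ∀ x y, 0 ≤ u x + v y + dist x y) :
    ∃ g : Z → ℝ, LipschitzWith 1 g ∧ (∀ x, -u x ≤ g x) ∧ ∀ x, g x ≤ v x := by
  haveI : Nonempty Z := ⟨e⟩
  have hb : ∀ x, BddBelow (Set.range fun y => v y + dist x y) := fun x =>
    ⟨-u x, by rintro _ ⟨y, rfl⟩; have := h x y; simp only; linarith⟩
  refine ⟨fun x => ⨅ y, (v y + dist x y), ?_, ?_, ?_⟩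
  · apply LipschitzWith.of_le_add
    intro x x'
    rw [ciInf_add (hb x')]
    refine le_ciInf fun y => (ciInf_le (hb x) y).trans ?_
    have := dist_triangle x x' y
    linarith
  · intro x
    exact le_ciInf fun y => by have := h x y; linarith
  · intro x
    simpa using ciInf_le (hb x) x

lemma rt_functional (e : Z) (p q : Measure Z) [IsFiniteMeasure p] [IsFiniteMeasure q]
    (hp : Integrable (fun z => dist z e) p) (hq : Integrable (fun z => dist z e) q)
    (hpq : p.real Set.univ = q.real Set.univ) (K : ℝ)
    (hK : IsLUB {r | ∃ g : Z → ℝ, LipschitzWith 1 g ∧ r = ∫ x, g x ∂p - ∫ x, g x ∂q} K) :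
    ∃ Λ : rtE e →ₗ[ℝ] ℝ, (∀ h : rtE e, (∀ z, 0 ≤ (h : Z × Z → ℝ) z) → 0 ≤ Λ h) ∧
      ∀ (h : rtE e) (u v : Z → ℝ) (t : ℝ), u ∈ rtU e → v ∈ rtU e →
        (∀ x y, (h : Z × Z → ℝ) (x, y) = u x + v y + t * dist x y) →
        Λ h = ∫ x, u x ∂p + ∫ y, v y ∂q + t * K := by
  let s : PointedCone ℝ (rtE e) :=
    { carrier := {h | ∀ z, 0 ≤ (h : Z × Z → ℝ) z}
      zero_mem' := fun z => le_rfl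
      add_mem' := fun {a b} ha hb z => add_nonneg (ha z) (hb z)
      smul_mem' := fun c x hx z => mul_nonneg c.2 (hx z) }
  have iu : ∀ u : rtU e, Integrable (u : Z → ℝ) p := fun u => by
    obtain ⟨hc, C, hC⟩ := u.2
    exact rt_growth_integrable hp hc hC
  have iv : ∀ u : rtU e, Integrable (u : Z → ℝ) q := fun u => by
    obtain ⟨hc, C, hC⟩ := u.2
    exact rt_growth_integrable hq hc hC
  have memT : ∀ w : rtU e × rtU e × ℝ, (fun z : Z × Z => (w.1 : Z → ℝ) z.1 +
      (w.2.1 : Z → ℝ) z.2 + w.2.2 * dist z.1 z.2) ∈ rtE e := by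
    rintro ⟨⟨u, hu, C, hC⟩, ⟨v, hv, D, hD⟩, t⟩
    refine ⟨|C| + |D| + |t|, fun z => ?_⟩
    simp only
    have h1 := abs_add_three (u z.1) (v z.2) (t * dist z.1 z.2)
    have h2 := hC z.1
    have h3 := hD z.2
    have h4 : |t * dist z.1 z.2| ≤ |t| * (dist z.1 e + dist z.2 e) := by
      rw [abs_mul, abs_of_nonneg dist_nonneg]
      exact mul_le_mul_of_nonneg_left (dist_triangle_right _ _ _) (abs_nonneg _)
    have a1 := dist_nonneg (x := z.1) (y := e)
    have a2 := dist_nonneg (x := z.2) (y := e)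
    have h5 : C * (1 + dist z.1 e) ≤ |C| * (1 + dist z.1 e + dist z.2 e) :=
      (mul_le_mul_of_nonneg_right (le_abs_self C) (by positivity)).trans
        (mul_le_mul_of_nonneg_left (by linarith) (abs_nonneg _))
    have h6 : D * (1 + dist z.2 e) ≤ |D| * (1 + dist z.1 e + dist z.2 e) :=
      (mul_le_mul_of_nonneg_right (le_abs_self D) (by positivity)).trans
        (mul_le_mul_of_nonneg_left (by linarith) (abs_nonneg _))
    have h7 : |t| * (dist z.1 e + dist z.2 e) ≤ |t| * (1 + dist z.1 e + dist z.2 e) :=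
      mul_le_mul_of_nonneg_left (by linarith) (abs_nonneg _)
    nlinarith
  let T : (rtU e × rtU e × ℝ) →ₗ[ℝ] rtE e :=
    { toFun := fun w => ⟨_, memT w⟩
      map_add' := fun a b => by
        ext z
        simp
        ring
      map_smul' := fun c a => by
        ext z
        simp
        ring }
  let L : (rtU e × rtU e × ℝ) →ₗ[ℝ] ℝ :=
    { toFun := fun w => ∫ x, (w.1 : Z → ℝ) x ∂p + ∫ x, (w.2.1 : Z → ℝ) x ∂q + w.2.2 * K
      map_add' := fun a b => by
        simp only [Prod.fst_add, Prod.snd_add, Submodule.coe_add, Pi.add_apply]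
        rw [integral_add (iu _) (iu _), integral_add (iv _) (iv _)]
        ring
      map_smul' := fun c a => by
        simp only [Prod.smul_fst, Prod.smul_snd, Submodule.coe_smul, Pi.smul_apply, smul_eq_mul,
          RingHom.id_apply]
        rw [integral_const_mul, integral_const_mul]
        ring }
  have hA : ∀ w, T w ∈ s → 0 ≤ L w := by
    rintro ⟨u, v, t⟩ hw
    have hw' : ∀ x y, 0 ≤ (u : Z → ℝ) x + (v : Z → ℝ) y + t * dist x y := fun x y => hw (x, y)
    change 0 ≤ ∫ x, (u : Z → ℝ) x ∂p + ∫ x, (v : Z → ℝ) x ∂q + t * K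
    rcases lt_or_ge 0 t with ht | ht
    · obtain ⟨g, hg, hg1, hg2⟩ := rt_ctransform (e := e) (u := fun x => t⁻¹ * (u : Z → ℝ) x)
        (v := fun x => t⁻¹ * (v : Z → ℝ) x) (by
          intro x y
          have := mul_nonneg (inv_nonneg.2 ht.le) (hw' x y)
          rw [mul_add, mul_add, ← mul_assoc t⁻¹ t, inv_mul_cancel₀ ht.ne', one_mul] at this
          exact this)
      have k1 := hK.1 ⟨g, hg, rfl⟩
      have k2 : ∫ x, -(t⁻¹ * (u : Z → ℝ) x) ∂p ≤ ∫ x, g x ∂p :=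
        integral_mono ((iu u).const_mul _).neg (rt_lip_integrable hp hg) hg1
      have k3 : ∫ x, g x ∂q ≤ ∫ x, t⁻¹ * (v : Z → ℝ) x ∂q :=
        integral_mono (rt_lip_integrable hq hg) ((iv v).const_mul _) hg2
      rw [integral_neg, integral_const_mul] at k2
      rw [integral_const_mul] at k3
      have k4 : 0 ≤ t⁻¹ * ∫ x, (u : Z → ℝ) x ∂p + t⁻¹ * ∫ x, (v : Z → ℝ) x ∂q + K := by linarith
      have := mul_nonneg ht.le k4
      rw [mul_add, mul_add, ← mul_assoc, ← mul_assoc, mul_inv_cancel₀ ht.ne', one_mul,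
        one_mul] at this
      exact this
    · have key : ∀ g : Z → ℝ, LipschitzWith 1 g →
          (-t) * (∫ x, g x ∂p - ∫ x, g x ∂q) ≤
            ∫ x, (u : Z → ℝ) x ∂p + ∫ x, (v : Z → ℝ) x ∂q := by
        intro g hg
        have := rt_prod_nonneg (e := e) hpq (u := fun x => (u : Z → ℝ) x + t * g x)
          (v := fun x => (v : Z → ℝ) x - t * g x)
          ((iu u).add ((rt_lip_integrable hp hg).const_mul t))
          ((iv v).sub ((rt_lip_integrable hq hg).const_mul t)) (by
            intro x y
            have h1 := hw' x y
            have h2 := hg.dist_le_mul x y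
            rw [Real.dist_eq, NNReal.coe_one, one_mul] at h2
            have h3 := (le_abs_self _).trans h2
            nlinarith)
        rw [integral_add (iu u) ((rt_lip_integrable hp hg).const_mul t),
          integral_sub (iv v) ((rt_lip_integrable hq hg).const_mul t),
          integral_const_mul, integral_const_mul] at this
        linarith
      rcases ht.eq_or_lt with ht | ht
      · have := key (fun _ => 0) (LipschitzWith.const 0 |>.weaken (by simp))
        rw [ht] at this ⊢
        simp at this ⊢
        exact this
      · have : K ≤ (∫ x, (u : Z → ℝ) x ∂p + ∫ x, (v : Z → ℝ) x ∂q) / (-t) := by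
          apply hK.2
          rintro r ⟨g, hg, rfl⟩
          rw [le_div_iff₀ (by linarith)]
          have := key g hg
          linarith
        rw [le_div_iff₀ (by linarith)] at this
        linarith
  have hB : ∀ h : rtE e, ∃ w, T w + h ∈ s := by
    rintro ⟨h, C, hC⟩
    have hU : ∀ c, (fun z : Z => |C| * (c + dist z e)) ∈ rtU e := fun c =>
      ⟨by fun_prop, |C| * (1 + |c|), fun z => by
        have a1 := dist_nonneg (x := z) (y := e)
        rw [abs_mul, abs_abs, mul_assoc]
        apply mul_le_mul_of_nonneg_left _ (abs_nonneg _)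
        have := abs_add_le c (dist z e)
        rw [abs_of_nonneg a1] at this
        nlinarith [abs_nonneg c]⟩
    refine ⟨(⟨_, hU 1⟩, ⟨_, hU 0⟩, 0), fun z => ?_⟩
    change 0 ≤ |C| * (1 + dist z.1 e) + |C| * (0 + dist z.2 e) + 0 * dist z.1 z.2 + h z
    have h1 := neg_le_of_abs_le (hC z)
    have a1 := dist_nonneg (x := z.1) (y := e)
    have a2 := dist_nonneg (x := z.2) (y := e)
    have h2 : C * (1 + dist z.1 e + dist z.2 e) ≤ |C| * (1 + dist z.1 e + dist z.2 e) :=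
      mul_le_mul_of_nonneg_right (le_abs_self C) (by positivity)
    nlinarith
  obtain ⟨Λ, h1, h2⟩ := rt_pos_ext s T L hA hB
  refine ⟨Λ, h2, ?_⟩
  intro h u v t hu hv hh
  have : h = T (⟨u, hu⟩, ⟨v, hv⟩, t) := by
    ext z
    exact hh z.1 z.2
  rw [this, h1]
  rfl

end Plan
section Plan2

lemma rt_plan [LocallyCompactSpace Z] [TopologicalSpace.SeparableSpace Z]
    (e : Z) (p q : Measure Z) [IsFiniteMeasure p] [IsFiniteMeasure q]
    (hp : Integrable (fun z => dist z e) p) (hq : Integrable (fun z => dist z e) q)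
    (hpq : p.real Set.univ = q.real Set.univ) (K : ℝ)
    (hK : IsLUB {r | ∃ g : Z → ℝ, LipschitzWith 1 g ∧ r = ∫ x, g x ∂p - ∫ x, g x ∂q} K) :
    ∃ π : Measure (Z × Z), IsFiniteMeasure π ∧ π.map Prod.fst = p ∧ π.map Prod.snd = q ∧
      Integrable (fun z : Z × Z => dist z.1 z.2) π ∧ ∫ z, dist z.1 z.2 ∂π ≤ K := by
  haveI : SecondCountableTopology Z := UniformSpace.secondCountable_of_separable Z
  obtain ⟨Λ, hΛpos, hΛ⟩ := rt_functional e p q hp hq hpq K hK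
  have hmono : ∀ f g : rtE e, (∀ z, (f : Z × Z → ℝ) z ≤ (g : Z × Z → ℝ) z) → Λ f ≤ Λ g := by
    intro f g h
    have := hΛpos (g - f) (fun z => by
      have := h z
      simp only [Submodule.coe_sub, Pi.sub_apply]; linarith)
    rw [map_sub] at this
    linarith
  have bddE : ∀ (f : Z × Z → ℝ) (C : ℝ), (∀ z, |f z| ≤ C) → f ∈ rtE e := by
    intro f C hC
    refine ⟨C, fun z => (hC z).trans ?_⟩
    have h0 : 0 ≤ C := (abs_nonneg _).trans (hC z)
    have a1 := dist_nonneg (x := z.1) (y := e)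
    have a2 := dist_nonneg (x := z.2) (y := e)
    nlinarith
  have bddU : ∀ (f : Z → ℝ) (C : ℝ), Continuous f → (∀ z, |f z| ≤ C) → f ∈ rtU e := by
    intro f C hf hC
    refine ⟨hf, C, fun z => (hC z).trans ?_⟩
    have h0 : 0 ≤ C := (abs_nonneg _).trans (hC z)
    have a1 := dist_nonneg (x := z) (y := e)
    nlinarith
  have ccE : ∀ f : CompactlySupportedContinuousMap (Z × Z) ℝ, (f : Z × Z → ℝ) ∈ rtE e := by
    intro f
    obtain ⟨C, hC⟩ := f.hasCompactSupport.exists_bound_of_continuous f.continuous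
    exact bddE f C hC
  let Φ : CompactlySupportedContinuousMap (Z × Z) ℝ →ₚ[ℝ] ℝ :=
    PositiveLinearMap.mk₀
      { toFun := fun f => Λ ⟨f, ccE f⟩
        map_add' := fun f g => by rw [← map_add]; rfl
        map_smul' := fun c g => by rw [← map_smul]; rfl }
      (fun f hf => hΛpos _ (fun z => hf z))
  let π := RealRMK.rieszMeasure Φ
  have hπ : ∀ (f : Z × Z → ℝ) (hf : f ∈ rtE e), Continuous f → HasCompactSupport f →
      ∫ z, f z ∂π = Λ ⟨f, hf⟩ := fun f hf h1 h2 =>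
    RealRMK.integral_rieszMeasure Φ ⟨⟨f, h1⟩, h2⟩
  -- cutoffs
  let Kx : CompactExhaustion Z := default
  have hχ : ∀ n, ∃ f : C(Z, ℝ), Set.EqOn f 1 (Kx n) ∧ HasCompactSupport f ∧
      ∀ x, f x ∈ Set.Icc (0 : ℝ) 1 := by
    intro n
    obtain ⟨f, h1, -, h3, h4⟩ := exists_continuous_one_zero_of_isCompact (Kx.isCompact n)
      isClosed_empty (Set.disjoint_empty _)
    exact ⟨f, h1, h3, h4⟩
  choose χ hχ1 hχs hχI using hχ
  have hχev : ∀ x, ∀ᶠ n in atTop, χ n x = 1 := by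
    intro x
    obtain ⟨n, hn⟩ := Kx.exists_mem x
    filter_upwards [eventually_ge_atTop n] with m hm
    exact hχ1 m (Kx.subset hm hn)
  have hχlim : ∀ (m : Measure Z) [IsFiniteMeasure m],
      Tendsto (fun n => ∫ x, χ n x ∂m) atTop (𝓝 (m.real Set.univ)) := by
    intro m _
    have h1 : m.real Set.univ = ∫ x, (1 : ℝ) ∂m := by simp
    rw [h1]
    refine tendsto_integral_of_dominated_convergence (fun _ => 1)
      (fun n => (χ n).continuous.measurable.aestronglyMeasurable) (integrable_const _) ?_ ?_
    · intro n
      refine Eventually.of_forall fun x => ?_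
      rw [Real.norm_eq_abs, abs_of_nonneg (hχI n x).1]
      exact (hχI n x).2
    · refine Eventually.of_forall fun x => ?_
      exact tendsto_const_nhds.congr' ((hχev x).mono fun n hn => hn.symm)
  let ψ : ℕ → Z × Z → ℝ := fun n z => χ n z.1 * χ n z.2
  have hψc : ∀ n, Continuous (ψ n) := fun n =>
    ((χ n).continuous.comp continuous_fst).mul ((χ n).continuous.comp continuous_snd)
  have hψ0 : ∀ n z, 0 ≤ ψ n z := fun n z => mul_nonneg (hχI n _).1 (hχI n _).1
  have hψ1 : ∀ n z, ψ n z ≤ 1 := fun n z => mul_le_one₀ (hχI n _).2 (hχI n _).1 (hχI n _).2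
  have hψs : ∀ n, HasCompactSupport (ψ n) := by
    intro n
    apply HasCompactSupport.intro ((hχs n).isCompact.prod (hχs n).isCompact)
    rintro ⟨x, y⟩ hxy
    rw [Set.mem_prod, not_and_or] at hxy
    rcases hxy with h | h
    · simp [ψ, image_eq_zero_of_notMem_tsupport h]
    · simp [ψ, image_eq_zero_of_notMem_tsupport h]
  have hψev : ∀ z, ∀ᶠ n in atTop, ψ n z = 1 := by
    intro z
    filter_upwards [hχev z.1, hχev z.2] with n h1 h2
    simp [ψ, h1, h2]
  -- Fatou
  have fatou : ∀ (h : Z × Z → ℝ) (hh : h ∈ rtE e), Continuous h → (∀ z, 0 ≤ h z) →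
      ∫⁻ z, ENNReal.ofReal (h z) ∂π ≤ ENNReal.ofReal (Λ ⟨h, hh⟩) := by
    intro h hh hc h0
    have hE : ∀ n, (fun z => h z * ψ n z) ∈ rtE e := by
      intro n
      obtain ⟨C, hC⟩ := hh
      refine ⟨C, fun z => le_trans ?_ (hC z)⟩
      rw [abs_mul, abs_of_nonneg (hψ0 n z)]
      exact mul_le_of_le_one_right (abs_nonneg _) (hψ1 n z)
    have e1 : ∀ n, ∫⁻ z, ENNReal.ofReal (h z * ψ n z) ∂π ≤ ENNReal.ofReal (Λ ⟨h, hh⟩) := by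
      intro n
      have hcs : HasCompactSupport (fun z => h z * ψ n z) := (hψs n).mul_left
      have hint : Integrable (fun z => h z * ψ n z) π :=
        (hc.mul (hψc n)).integrable_of_hasCompactSupport hcs
      rw [← ofReal_integral_eq_lintegral_ofReal hint
        (Eventually.of_forall fun z => mul_nonneg (h0 z) (hψ0 n z)),
        hπ _ (hE n) (hc.mul (hψc n)) hcs]
      apply ENNReal.ofReal_le_ofReal
      apply hmono
      intro z
      exact mul_le_of_le_one_right (h0 z) (hψ1 n z)
    calc ∫⁻ z, ENNReal.ofReal (h z) ∂π
        = ∫⁻ z, liminf (fun n => ENNReal.ofReal (h z * ψ n z)) atTop ∂π := by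
          apply lintegral_congr
          intro z
          symm
          apply Tendsto.liminf_eq
          apply tendsto_const_nhds.congr'
          filter_upwards [hψev z] with n hn
          rw [hn, mul_one]
      _ ≤ liminf (fun n => ∫⁻ z, ENNReal.ofReal (h z * ψ n z) ∂π) atTop :=
          lintegral_liminf_le fun n => (hc.mul (hψc n)).measurable.ennreal_ofReal
      _ ≤ ENNReal.ofReal (Λ ⟨h, hh⟩) := by
          refine (liminf_le_liminf (Eventually.of_forall e1)).trans ?_
          simp
  have one_mem : (fun _ : Z × Z => (1 : ℝ)) ∈ rtE e := bddE _ 1 (by simp)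
  have hΛ1 : Λ ⟨_, one_mem⟩ = p.real Set.univ := by
    rw [hΛ ⟨_, one_mem⟩ (fun _ => 1) (fun _ => 0) 0 (bddU _ 1 continuous_const (by simp))
      (bddU _ 0 continuous_const (by simp)) (by simp)]
    simp
  have hfin : π Set.univ ≤ ENNReal.ofReal (p.real Set.univ) := by
    have := fatou _ one_mem continuous_const (by simp)
    rw [hΛ1] at this
    simpa using this
  haveI hπfin : IsFiniteMeasure π := ⟨hfin.trans_lt ENNReal.ofReal_lt_top⟩
  have hmass : π.real Set.univ = p.real Set.univ := by
    apply le_antisymm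
    · exact ENNReal.toReal_le_of_le_ofReal measureReal_nonneg hfin
    · have hlow : ∀ n, ∫ x, χ n x ∂p + ∫ x, χ n x ∂q - p.real Set.univ ≤ π.real Set.univ := by
        intro n
        have hψE : ψ n ∈ rtE e := bddE _ 1 (fun z => by
          rw [abs_of_nonneg (hψ0 n z)]; exact hψ1 n z)
        have hχU : (fun x => χ n x) ∈ rtU e := bddU _ 1 (χ n).continuous (fun z => by
          rw [abs_of_nonneg (hχI n z).1]; exact (hχI n z).2)
        have hχU' : (fun x => χ n x - 1) ∈ rtU e := bddU _ 1
          ((χ n).continuous.sub continuous_const) (fun z => by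
            have h1 := (hχI n z).1
            have h2 := (hχI n z).2
            rw [abs_le]; constructor <;> linarith)
        have hE2 : (fun z : Z × Z => χ n z.1 + (χ n z.2 - 1)) ∈ rtE e := bddE _ 1 (fun z => by
            have h1 := (hχI n z.1).1
            have h2 := (hχI n z.1).2
            have h3 := (hχI n z.2).1
            have h4 := (hχI n z.2).2
            rw [abs_le]; constructor <;> linarith)
        have i1 : Integrable (fun x => χ n x) q := by
          obtain ⟨hc, C, hC⟩ := hχU
          exact rt_growth_integrable hq hc hC
        have k1 : Λ ⟨_, hE2⟩ = ∫ x, χ n x ∂p + ∫ x, χ n x ∂q - p.real Set.univ := by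
          rw [hΛ ⟨_, hE2⟩ _ _ 0 hχU hχU' (by intro x y; simp),
            integral_sub i1 (integrable_const _), hpq]
          simp
          ring
        have k2 : Λ ⟨_, hE2⟩ ≤ Λ ⟨_, hψE⟩ := hmono _ _ (fun z => by
          change χ n z.1 + (χ n z.2 - 1) ≤ χ n z.1 * χ n z.2
          have h2 := (hχI n z.1).2
          have h4 := (hχI n z.2).2
          nlinarith)
        rw [← hπ _ hψE (hψc n) (hψs n)] at k2
        have k3 : ∫ z, ψ n z ∂π ≤ ∫ z, (1 : ℝ) ∂π :=
          integral_mono ((hψc n).integrable_of_hasCompactSupport (hψs n)) (integrable_const _)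
            (hψ1 n)
        simp at k3
        linarith
      have hl := (((hχlim p).add (hχlim q)).sub_const (p.real Set.univ))
      have := le_of_tendsto' hl hlow
      linarith
  -- marginals
  have upper : ∀ (u : Z → ℝ) (C : ℝ), Continuous u → (∀ x, 0 ≤ u x) → (∀ x, u x ≤ C) →
      ∫ z, u z.1 ∂π ≤ ∫ x, u x ∂p ∧ ∫ z, u z.2 ∂π ≤ ∫ x, u x ∂q := by
    intro u C hc h0 hC
    have habs : ∀ x, |u x| ≤ C := fun x => by rw [abs_of_nonneg (h0 x)]; exact hC x
    have hE1 : (fun z : Z × Z => u z.1) ∈ rtE e := bddE _ C fun z => habs _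
    have hE2 : (fun z : Z × Z => u z.2) ∈ rtE e := bddE _ C fun z => habs _
    have hU := bddU u C hc habs
    have hU0 : (fun _ : Z => (0 : ℝ)) ∈ rtU e := (rtU e).zero_mem
    constructor
    · have h1 := fatou _ hE1 (hc.comp continuous_fst) (fun z => h0 _)
      rw [hΛ ⟨_, hE1⟩ u (fun _ => 0) 0 hU hU0 (by simp)] at h1
      rw [integral_eq_lintegral_of_nonneg_ae (Eventually.of_forall fun z => h0 _)
        (hc.comp continuous_fst).measurable.aestronglyMeasurable]
      apply ENNReal.toReal_le_of_le_ofReal (integral_nonneg h0)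
      simpa using h1
    · have h1 := fatou _ hE2 (hc.comp continuous_snd) (fun z => h0 _)
      rw [hΛ ⟨_, hE2⟩ (fun _ => 0) u 0 hU0 hU (by simp)] at h1
      rw [integral_eq_lintegral_of_nonneg_ae (Eventually.of_forall fun z => h0 _)
        (hc.comp continuous_snd).measurable.aestronglyMeasurable]
      apply ENNReal.toReal_le_of_le_ofReal (integral_nonneg h0)
      simpa using h1
  have marg : ∀ f : BoundedContinuousFunction Z ℝ,
      ∫ z, f z.1 ∂π = ∫ x, f x ∂p ∧ ∫ z, f z.2 ∂π = ∫ x, f x ∂q := by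
    intro f
    have hb : ∀ x, |f x| ≤ ‖f‖ := fun x => f.norm_coe_le_norm x
    have i1 : Integrable (fun z : Z × Z => f z.1) π :=
      Integrable.of_bound (f.continuous.comp continuous_fst).measurable.aestronglyMeasurable ‖f‖
        (Eventually.of_forall fun z => hb _)
    have i2 : Integrable (fun z : Z × Z => f z.2) π :=
      Integrable.of_bound (f.continuous.comp continuous_snd).measurable.aestronglyMeasurable ‖f‖
        (Eventually.of_forall fun z => hb _)
    obtain ⟨a1, a2⟩ := upper (fun x => ‖f‖ + f x) (2 * ‖f‖) (continuous_const.add f.continuous)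
      (fun x => by have := (abs_le.1 (hb x)).1; linarith)
      (fun x => by have := (abs_le.1 (hb x)).2; linarith)
    obtain ⟨b1, b2⟩ := upper (fun x => ‖f‖ - f x) (2 * ‖f‖) (continuous_const.sub f.continuous)
      (fun x => by have := (abs_le.1 (hb x)).2; linarith)
      (fun x => by have := (abs_le.1 (hb x)).1; linarith)
    rw [integral_add (integrable_const _) i1, integral_add (integrable_const _) (f.integrable p)]
      at a1
    rw [integral_add (integrable_const _) i2, integral_add (integrable_const _) (f.integrable q)]
      at a2
    rw [integral_sub (integrable_const _) i1, integral_sub (integrable_const _) (f.integrable p)]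
      at b1
    rw [integral_sub (integrable_const _) i2, integral_sub (integrable_const _) (f.integrable q)]
      at b2
    simp only [integral_const, smul_eq_mul, hmass, ← hpq] at a1 a2 b1 b2
    constructor <;> linarith
  have hdE : (fun z : Z × Z => dist z.1 z.2) ∈ rtE e := ⟨1, fun z => by
    rw [abs_of_nonneg dist_nonneg]
    have := dist_triangle_right z.1 z.2 e
    linarith⟩
  have hd := fatou _ hdE (by fun_prop) (fun z => dist_nonneg)
  have hΛd : Λ ⟨_, hdE⟩ = K := by
    rw [hΛ ⟨_, hdE⟩ (fun _ => 0) (fun _ => 0) 1 (rtU e).zero_mem (rtU e).zero_mem (by simp)]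
    simp
  rw [hΛd] at hd
  have hK0 : 0 ≤ K := by
    have := hΛpos ⟨_, hdE⟩ (fun z => dist_nonneg)
    rwa [hΛd] at this
  have hdm : Measurable (fun z : Z × Z => dist z.1 z.2) :=
    (by fun_prop : Continuous (fun z : Z × Z => dist z.1 z.2)).measurable
  refine ⟨π, hπfin, ?_, ?_, ?_, ?_⟩
  · apply ext_of_forall_integral_eq_of_IsFiniteMeasure
    intro f
    rw [integral_map measurable_fst.aemeasurable f.continuous.measurable.aestronglyMeasurable]
    exact (marg f).1
  · apply ext_of_forall_integral_eq_of_IsFiniteMeasure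
    intro f
    rw [integral_map measurable_snd.aemeasurable f.continuous.measurable.aestronglyMeasurable]
    exact (marg f).2
  · refine ⟨hdm.aestronglyMeasurable, ?_⟩
    rw [hasFiniteIntegral_iff_ofReal (Eventually.of_forall fun z => dist_nonneg)]
    exact hd.trans_lt ENNReal.ofReal_lt_top
  · rw [integral_eq_lintegral_of_nonneg_ae (Eventually.of_forall fun z => dist_nonneg)
      hdm.aestronglyMeasurable]
    exact ENNReal.toReal_le_of_le_ofReal hK0 hd

end Plan2
section SignedPart

lemma rt_sInteg_sub (P Q : Measure Z) [IsFiniteMeasure P] [IsFiniteMeasure Q] {f : Z → ℝ}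
    (hP : Integrable f P) (hQ : Integrable f Q) :
    sInteg (P.toSignedMeasure - Q.toSignedMeasure) f = ∫ z, f z ∂P - ∫ z, f z ∂Q := by
  unfold sInteg
  rw [Measure.toJordanDecomposition_toSignedMeasure_sub,
    Measure.jordanDecompositionOfToSignedMeasureSub_posPart,
    Measure.jordanDecompositionOfToSignedMeasureSub_negPart]
  have h := Measure.sub_toSignedMeasure_eq_toSignedMeasure_sub (μ := P) (ν := Q)
  rw [sub_eq_sub_iff_add_eq_add, ← Measure.toSignedMeasure_add, ← Measure.toSignedMeasure_add,
    Measure.toSignedMeasure_eq_toSignedMeasure_iff] at h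
  have h1 : ∫ z, f z ∂(P + (Q - P)) = ∫ z, f z ∂((P - Q) + Q) := by rw [h]
  rw [integral_add_measure hP (hQ.mono_measure Measure.sub_le),
    integral_add_measure (hP.mono_measure Measure.sub_le) hQ] at h1
  linarith

lemma rt_tv_le (P Q : Measure Z) [IsFiniteMeasure P] [IsFiniteMeasure Q] :
    (P.toSignedMeasure - Q.toSignedMeasure).totalVariation ≤ P + Q := by
  unfold SignedMeasure.totalVariation
  rw [Measure.toJordanDecomposition_toSignedMeasure_sub,
    Measure.jordanDecompositionOfToSignedMeasureSub_posPart,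
    Measure.jordanDecompositionOfToSignedMeasureSub_negPart]
  exact add_le_add Measure.sub_le Measure.sub_le

lemma rt_bounds {e : Z} (P Q : Measure Z) [IsFiniteMeasure P] [IsFiniteMeasure Q]
    (hP : Integrable (fun z => dist z e) P) (hQ : Integrable (fun z => dist z e) Q) {k : ℝ}
    (hk : ∀ f : Z → ℝ, f e = 0 → LipschitzWith 1 f → ∫ z, f z ∂P - ∫ z, f z ∂Q ≤ k) :
    MemM1 e (P.toSignedMeasure - Q.toSignedMeasure) ∧
    kruNorm e (P.toSignedMeasure - Q.toSignedMeasure) ≤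
      |P.real Set.univ - Q.real Set.univ| + k ∧
    (momLint e 1 (P.toSignedMeasure - Q.toSignedMeasure)).toReal ≤
      ∫ z, (1 + dist z e) ∂P + ∫ z, (1 + dist z e) ∂Q := by
  refine ⟨?_, ?_, ?_⟩
  · unfold MemM1
    refine (lintegral_mono' (rt_tv_le P Q) le_rfl).trans_lt ?_
    rw [lintegral_add_measure, ← ofReal_integral_eq_lintegral_ofReal hP
      (Eventually.of_forall fun _ => dist_nonneg), ← ofReal_integral_eq_lintegral_ofReal hQ
      (Eventually.of_forall fun _ => dist_nonneg)]
    exact ENNReal.add_lt_top.2 ⟨ENNReal.ofReal_lt_top, ENNReal.ofReal_lt_top⟩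
  · unfold kruNorm
    refine add_le_add (le_of_eq ?_) ?_
    · rw [_root_.sub_apply, Measure.toSignedMeasure_apply_measurable MeasurableSet.univ,
        Measure.toSignedMeasure_apply_measurable MeasurableSet.univ]
    · apply csSup_le
      · exact ⟨_, fun _ => 0, rfl, (LipschitzWith.const 0).weaken (by simp), rfl⟩
      · rintro r ⟨f, hf0, hf, rfl⟩
        rw [rt_sInteg_sub P Q (rt_lip_integrable hP hf) (rt_lip_integrable hQ hf)]
        exact hk f hf0 hf
  · have n0 : ∀ z : Z, 0 ≤ 1 + dist z e := fun z => by positivity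
    have iP : Integrable (fun z => 1 + dist z e) P := (integrable_const 1).add hP
    have iQ : Integrable (fun z => 1 + dist z e) Q := (integrable_const 1).add hQ
    apply ENNReal.toReal_le_of_le_ofReal
      (add_nonneg (integral_nonneg n0) (integral_nonneg n0))
    unfold momLint
    simp only [Real.rpow_one]
    refine (lintegral_mono' (rt_tv_le P Q) le_rfl).trans ?_
    rw [lintegral_add_measure, ← ofReal_integral_eq_lintegral_ofReal iP
      (Eventually.of_forall n0), ← ofReal_integral_eq_lintegral_ofReal iQ
      (Eventually.of_forall n0), ENNReal.ofReal_add (integral_nonneg n0) (integral_nonneg n0)]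

/-- upper bound certificate for the regularizer -/
def rtWit (e : Z) (α β : ℝ) (μ : SignedMeasure Z) (t : ℝ) : Prop :=
  ∃ (P Q : Measure Z) (_ : IsFiniteMeasure P) (_ : IsFiniteMeasure Q) (k : ℝ),
    μ = P.toSignedMeasure - Q.toSignedMeasure ∧
    Integrable (fun z => dist z e) P ∧ Integrable (fun z => dist z e) Q ∧
    (∀ f : Z → ℝ, f e = 0 → LipschitzWith 1 f → ∫ z, f z ∂P - ∫ z, f z ∂Q ≤ k) ∧
    α * (|P.real Set.univ - Q.real Set.univ| + k) +
      β * (∫ z, (1 + dist z e) ∂P + ∫ z, (1 + dist z e) ∂Q) ≤ t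

lemma rtWit.bound {e : Z} {α β : ℝ} (hα : 0 < α) (hβ : 0 < β) {μ : SignedMeasure Z} {t : ℝ}
    (h : rtWit e α β μ t) :
    MemM1 e μ ∧ α * kruNorm e μ + β * (momLint e 1 μ).toReal ≤ t := by
  obtain ⟨P, Q, _, _, k, rfl, hP, hQ, hk, ht⟩ := h
  obtain ⟨h1, h2, h3⟩ := rt_bounds P Q hP hQ hk
  refine ⟨h1, le_trans ?_ ht⟩
  gcongr

lemma rtWit.zero {e : Z} {α β : ℝ} : rtWit e α β 0 0 := by
  refine ⟨0, 0, inferInstance, inferInstance, 0, by simp, by simp, by simp, by simp, by simp⟩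

lemma rtWit.add {e : Z} {α β : ℝ} (hα : 0 < α) {μ ν : SignedMeasure Z} {s t : ℝ}
    (h : rtWit e α β μ s) (h' : rtWit e α β ν t) : rtWit e α β (μ + ν) (s + t) := by
  obtain ⟨P, Q, _, _, k, rfl, hP, hQ, hk, ht⟩ := h
  obtain ⟨P', Q', _, _, k', rfl, hP', hQ', hk', ht'⟩ := h'
  refine ⟨P + P', Q + Q', inferInstance, inferInstance, k + k', ?_, hP.add_measure hP',
    hQ.add_measure hQ', ?_, ?_⟩
  · rw [Measure.toSignedMeasure_add, Measure.toSignedMeasure_add]; abel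
  · intro f hf0 hf
    rw [integral_add_measure (rt_lip_integrable hP hf) (rt_lip_integrable hP' hf),
      integral_add_measure (rt_lip_integrable hQ hf) (rt_lip_integrable hQ' hf)]
    have := hk f hf0 hf
    have := hk' f hf0 hf
    linarith
  · have i1 : ∀ {m : Measure Z} [IsFiniteMeasure m], Integrable (fun z => dist z e) m →
        Integrable (fun z => 1 + dist z e) m := fun h => (integrable_const 1).add h
    rw [integral_add_measure (i1 hP) (i1 hP'), integral_add_measure (i1 hQ) (i1 hQ'),
      measureReal_add_apply, measureReal_add_apply]
    have h1 := abs_add_le (P.real Set.univ - Q.real Set.univ)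
      (P'.real Set.univ - Q'.real Set.univ)
    have h2 : P.real Set.univ + P'.real Set.univ - (Q.real Set.univ + Q'.real Set.univ) =
      (P.real Set.univ - Q.real Set.univ) + (P'.real Set.univ - Q'.real Set.univ) := by ring
    rw [h2]
    have := mul_le_mul_of_nonneg_left h1 hα.le
    linarith

lemma rtWit.smul {e : Z} {α β : ℝ} {μ : SignedMeasure Z} {t c : ℝ} (hc : 0 ≤ c)
    (h : rtWit e α β μ t) : rtWit e α β (c • μ) (c * t) := by
  lift c to ℝ≥0 using hc
  obtain ⟨P, Q, _, _, k, rfl, hP, hQ, hk, ht⟩ := h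
  refine ⟨c • P, c • Q, inferInstance, inferInstance, c * k, ?_, hP.smul_measure_nnreal,
    hQ.smul_measure_nnreal, ?_, ?_⟩
  · rw [Measure.toSignedMeasure_smul, Measure.toSignedMeasure_smul, smul_sub]; rfl
  · intro f hf0 hf
    rw [integral_smul_nnreal_measure, integral_smul_nnreal_measure, NNReal.smul_def,
      NNReal.smul_def, smul_eq_mul, smul_eq_mul, ← mul_sub]
    exact mul_le_mul_of_nonneg_left (hk f hf0 hf) c.2
  · rw [integral_smul_nnreal_measure, integral_smul_nnreal_measure, NNReal.smul_def,
      NNReal.smul_def, smul_eq_mul, smul_eq_mul, measureReal_nnreal_smul_apply,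
      measureReal_nnreal_smul_apply, ← mul_sub, abs_mul, NNReal.abs_eq]
    have := mul_le_mul_of_nonneg_left ht c.2
    refine le_trans (le_of_eq ?_) this
    change _ = (c : ℝ) * _
    ring

lemma rtWit.mono {e : Z} {α β : ℝ} {μ : SignedMeasure Z} {s t : ℝ} (hst : s ≤ t)
    (h : rtWit e α β μ s) : rtWit e α β μ t := by
  obtain ⟨P, Q, i1, i2, k, h1, h2, h3, h4, h5⟩ := h
  exact ⟨P, Q, i1, i2, k, h1, h2, h3, h4, h5.trans hst⟩

lemma rt_integrable_dirac {e x : Z} :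
    Integrable (fun z => dist z e) (Measure.dirac x) :=
  integrable_dirac (by simp)

lemma rt_lip_apply {f : Z → ℝ} (hf : LipschitzWith 1 f) (x y : Z) : f x - f y ≤ dist x y := by
  have := hf.dist_le_mul x y
  rw [Real.dist_eq, NNReal.coe_one, one_mul] at this
  exact (le_abs_self _).trans this

lemma rtWit.dipole {e : Z} {α β : ℝ} (z w : Z) :
    rtWit e α β (diracSM z - diracSM w)
      (α * dist z w + β * (1 + dist z e + (1 + dist w e))) := by
  refine ⟨Measure.dirac z, Measure.dirac w, inferInstance, inferInstance, dist z w, rfl,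
    rt_integrable_dirac, rt_integrable_dirac, ?_, ?_⟩
  · intro f hf0 hf
    rw [integral_dirac, integral_dirac]
    exact rt_lip_apply hf z w
  · rw [integral_dirac, integral_dirac]
    simp

lemma rtWit.mono_pos {e : Z} {α β : ℝ} (z : Z) :
    rtWit e α β (diracSM z) (α * (1 + dist z e) + β * (1 + dist z e)) := by
  refine ⟨Measure.dirac z, 0, inferInstance, inferInstance, dist z e, ?_,
    rt_integrable_dirac, by simp, ?_, ?_⟩
  · simp [diracSM]
  · intro f hf0 hf
    rw [integral_dirac]
    have := rt_lip_apply hf z e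
    simp [hf0] at this ⊢
    exact this
  · rw [integral_dirac]
    simp

lemma rtWit.mono_neg {e : Z} {α β : ℝ} (z : Z) :
    rtWit e α β (-diracSM z) (α * (1 + dist z e) + β * (1 + dist z e)) := by
  refine ⟨0, Measure.dirac z, inferInstance, inferInstance, dist z e, ?_, by simp,
    rt_integrable_dirac, ?_, ?_⟩
  · simp [diracSM]
  · intro f hf0 hf
    rw [integral_dirac]
    have := rt_lip_apply hf e z
    rw [dist_comm] at this
    simp [hf0] at this ⊢
    linarith
  · rw [integral_dirac]
    simp

/-- exact decomposition of the regularizer -/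
lemma rt_decomp {e : Z} {μ : SignedMeasure Z} (hμ : MemM1 e μ) :
    ∃ (P Q : Measure Z) (_ : IsFiniteMeasure P) (_ : IsFiniteMeasure Q) (K : ℝ),
      μ = P.toSignedMeasure - Q.toSignedMeasure ∧
      Integrable (fun z => dist z e) P ∧ Integrable (fun z => dist z e) Q ∧
      IsLUB {r | ∃ f : Z → ℝ, (f e = 0 ∧ LipschitzWith 1 f) ∧
        r = ∫ z, f z ∂P - ∫ z, f z ∂Q} K ∧
      kruNorm e μ = |P.real Set.univ - Q.real Set.univ| + K ∧
      (momLint e 1 μ).toReal = ∫ z, (1 + dist z e) ∂P + ∫ z, (1 + dist z e) ∂Q := by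
  have hm : Measurable (fun z : Z => dist z e) := by
    have : Continuous (fun z : Z => dist z e) := by fun_prop
    exact this.measurable
  set P := μ.toJordanDecomposition.posPart with hPdef
  set Q := μ.toJordanDecomposition.negPart with hQdef
  have hμeq : μ = P.toSignedMeasure - Q.toSignedMeasure :=
    (SignedMeasure.toSignedMeasure_toJordanDecomposition μ).symm
  have htv : μ.totalVariation = P + Q := rfl
  have hμ' := hμ
  unfold MemM1 at hμ'
  rw [htv, lintegral_add_measure, ENNReal.add_lt_top] at hμ'
  have hP : Integrable (fun z => dist z e) P := ⟨hm.aestronglyMeasurable, by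
    rw [hasFiniteIntegral_iff_ofReal (Eventually.of_forall fun z => dist_nonneg)]
    exact hμ'.1⟩
  have hQ : Integrable (fun z => dist z e) Q := ⟨hm.aestronglyMeasurable, by
    rw [hasFiniteIntegral_iff_ofReal (Eventually.of_forall fun z => dist_nonneg)]
    exact hμ'.2⟩
  have n0 : ∀ z : Z, 0 ≤ 1 + dist z e := fun z => by positivity
  have iP : Integrable (fun z => 1 + dist z e) P := (integrable_const 1).add hP
  have iQ : Integrable (fun z => 1 + dist z e) Q := (integrable_const 1).add hQ
  have hset : {r : ℝ | ∃ f : Z → ℝ, f e = 0 ∧ LipschitzWith 1 f ∧ r = sInteg μ f} =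
      {r | ∃ f : Z → ℝ, (f e = 0 ∧ LipschitzWith 1 f) ∧ r = ∫ z, f z ∂P - ∫ z, f z ∂Q} := by
    ext r
    constructor
    · rintro ⟨f, h0, hf, rfl⟩
      exact ⟨f, ⟨h0, hf⟩, rfl⟩
    · rintro ⟨f, ⟨h0, hf⟩, rfl⟩
      exact ⟨f, h0, hf, rfl⟩
  refine ⟨P, Q, inferInstance, inferInstance,
    sSup {r : ℝ | ∃ f : Z → ℝ, f e = 0 ∧ LipschitzWith 1 f ∧ r = sInteg μ f}, hμeq, hP, hQ,
    ?_, ?_, ?_⟩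
  · rw [hset]
    apply isLUB_csSup
    · exact ⟨_, fun _ => 0, ⟨rfl, (LipschitzWith.const 0).weaken (by simp)⟩, rfl⟩
    · refine ⟨∫ z, dist z e ∂P + ∫ z, dist z e ∂Q, ?_⟩
      rintro r ⟨f, ⟨h0, hf⟩, rfl⟩
      have k1 : ∫ z, f z ∂P ≤ ∫ z, dist z e ∂P :=
        integral_mono (rt_lip_integrable hP hf) hP (fun z => by
          have := rt_lip_apply hf z e
          rw [h0] at this
          simpa using this)
      have k2 : ∫ z, -dist z e ∂Q ≤ ∫ z, f z ∂Q :=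
        integral_mono hQ.neg (rt_lip_integrable hQ hf) (fun z => by
          have := rt_lip_apply hf e z
          rw [h0, dist_comm] at this
          simp only
          linarith)
      rw [integral_neg] at k2
      linarith
  · unfold kruNorm
    congr 2
    conv_lhs => rw [hμeq]
    rw [_root_.sub_apply, Measure.toSignedMeasure_apply_measurable MeasurableSet.univ,
      Measure.toSignedMeasure_apply_measurable MeasurableSet.univ]
  · unfold momLint
    simp only [Real.rpow_one]
    rw [htv, lintegral_add_measure, ← ofReal_integral_eq_lintegral_ofReal iP
      (Eventually.of_forall n0), ← ofReal_integral_eq_lintegral_ofReal iQ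
      (Eventually.of_forall n0), ← ENNReal.ofReal_add (integral_nonneg n0) (integral_nonneg n0),
      ENNReal.toReal_ofReal (add_nonneg (integral_nonneg n0) (integral_nonneg n0))]

end SignedPart
section OperatorPart

lemma rt_map_simple (P : Measure Z) [IsFiniteMeasure P] (s : SimpleFunc Z Z) :
    (P.map s).toSignedMeasure = ∑ x ∈ s.range, P.real (s ⁻¹' {x}) • diracSM x := by
  ext B hB
  have h0 : (∑ x ∈ s.range, P.real (s ⁻¹' {x}) • diracSM x) B =
      ∑ x ∈ s.range, P.real (s ⁻¹' {x}) * (Measure.dirac x).real B := by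
    have := map_sum (FunLike.coeAddMonoidHom (SignedMeasure Z) (Set Z) ℝ)
      (fun x => P.real (s ⁻¹' {x}) • diracSM x) s.range
    have h2 := congrFun this B
    rw [Finset.sum_apply] at h2
    refine h2.trans (Finset.sum_congr rfl fun x _ => ?_)
    change P.real (s ⁻¹' {x}) • (diracSM x) B = _
    rw [diracSM, Measure.toSignedMeasure_apply_measurable hB, smul_eq_mul]
  rw [Measure.toSignedMeasure_apply_measurable hB, h0]
  rw [map_measureReal_apply s.measurable hB]
  have h1 : s ⁻¹' B = ⋃ x ∈ s.range.filter (· ∈ B), s ⁻¹' {x} := by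
    ext z
    simp
  rw [h1, measureReal_biUnion_finset]
  · rw [Finset.sum_filter]
    apply Finset.sum_congr rfl
    intro x _
    by_cases hx : x ∈ B
    · simp [hx, measureReal_def, Measure.dirac_apply' _ hB]
    · simp [hx, measureReal_def, Measure.dirac_apply' _ hB]
  · intro x _ y _ hxy
    exact Disjoint.preimage _ (by simpa using hxy)
  · intro x _
    exact s.measurableSet_fiber x

lemma rt_integral_simple {F : Type*} [NormedAddCommGroup F] [NormedSpace ℝ F] [CompleteSpace F]
    (P : Measure Z) [IsFiniteMeasure P] (s : SimpleFunc Z Z) (a : Z → F) :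
    ∫ z, a (s z) ∂P = ∑ x ∈ s.range, P.real (s ⁻¹' {x}) • a x := by
  have h1 : ∀ z, a (s z) = ∑ x ∈ s.range, (s ⁻¹' {x}).indicator (fun _ => a x) z := by
    intro z
    rw [Finset.sum_eq_single (s z)]
    · simp
    · intro x _ hx
      rw [Set.indicator_of_notMem]
      simpa using hx.symm
    · intro h
      exact absurd (s.mem_range_self z) h
  simp_rw [h1]
  rw [integral_finsetSum]
  · apply Finset.sum_congr rfl
    intro x _
    rw [integral_indicator (s.measurableSet_fiber x)]
    simp
  · intro x _
    exact (integrable_const _).indicator (s.measurableSet_fiber x)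

lemma rt_A_integral [TopologicalSpace.SeparableSpace Z] {e : Z} {N : ℕ}
    (A : SignedMeasure Z →ₗ[ℝ] EuclideanSpace ℝ (Fin N)) {C : ℝ} (hC0 : 0 ≤ C)
    (hC : ∀ μ : SignedMeasure Z, MemM1 e μ → ‖A μ‖ ≤ C * kruNorm e μ) :
    LipschitzWith C.toNNReal (fun z => A (diracSM z)) ∧
    ∀ (P : Measure Z) [IsFiniteMeasure P], Integrable (fun z => dist z e) P →
      Integrable (fun z => A (diracSM z)) P ∧
      A P.toSignedMeasure = ∫ z, A (diracSM z) ∂P := by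
  haveI : SecondCountableTopology Z := UniformSpace.secondCountable_of_separable Z
  have hlip : LipschitzWith C.toNNReal (fun z => A (diracSM z)) := by
    apply LipschitzWith.of_dist_le_mul
    intro x y
    rw [dist_eq_norm, ← map_sub, Real.coe_toNNReal _ hC0]
    obtain ⟨h1, h2, -⟩ := rt_bounds (e := e) (Measure.dirac x) (Measure.dirac y)
      rt_integrable_dirac rt_integrable_dirac (k := dist x y) (by
        intro f _ hf
        rw [integral_dirac, integral_dirac]
        exact rt_lip_apply hf x y)
    refine (hC _ h1).trans ?_
    apply mul_le_mul_of_nonneg_left _ hC0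
    simpa using h2
  refine ⟨hlip, fun P _ hP => ?_⟩
  set a : Z → EuclideanSpace ℝ (Fin N) := fun z => A (diracSM z) with ha
  have hai : Integrable a P := by
    refine Integrable.mono' (g := fun z => ‖a e‖ + C * dist z e)
      ((integrable_const _).add (hP.const_mul C)) hlip.continuous.measurable.aestronglyMeasurable ?_
    refine Eventually.of_forall fun z => ?_
    have h1 := hlip.dist_le_mul z e
    rw [dist_eq_norm, Real.coe_toNNReal _ hC0] at h1
    have h2 := norm_add_le (a z - a e) (a e)
    rw [sub_add_cancel] at h2
    linarith
  refine ⟨hai, ?_⟩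
  let s : ℕ → SimpleFunc Z Z := fun n =>
    SimpleFunc.approxOn (id : Z → Z) measurable_id Set.univ e (Set.mem_univ e) n
  have hs_le : ∀ n z, dist e (s n z) ≤ 2 * dist z e := by
    intro n z
    have := SimpleFunc.edist_approxOn_y0_le (f := (id : Z → Z)) measurable_id (s := Set.univ)
      (Set.mem_univ e) z n
    simp only [edist_dist, id] at this
    rw [← ENNReal.ofReal_add dist_nonneg dist_nonneg,
      ENNReal.ofReal_le_ofReal_iff (by positivity)] at this
    rw [dist_comm z e]
    linarith
  have hs_lim : ∀ z, Tendsto (fun n => dist z (s n z)) atTop (𝓝 0) := by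
    intro z
    have := SimpleFunc.tendsto_approxOn (f := (id : Z → Z)) measurable_id (s := Set.univ)
      (Set.mem_univ e) (x := z) (by simp)
    have h2 := (tendsto_const_nhds (x := z)).dist this
    simpa using h2
  have hsm : ∀ n, Measurable (fun z => dist z (s n z)) := fun n =>
    measurable_id.dist (s n).measurable
  have hsb : ∀ n z, dist z (s n z) ≤ 3 * dist z e := fun n z => by
    have := dist_triangle z e (s n z)
    have := hs_le n z
    linarith
  have hsi : ∀ n, Integrable (fun z => dist z (s n z)) P := fun n =>
    (hP.const_mul 3).mono' (hsm n).aestronglyMeasurable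
      (Eventually.of_forall fun z => by
        rw [Real.norm_eq_abs, abs_of_nonneg dist_nonneg]; exact hsb n z)
  have hlim : Tendsto (fun n => ∫ z, dist z (s n z) ∂P) atTop (𝓝 0) := by
    have : (0 : ℝ) = ∫ z, (0 : ℝ) ∂P := by simp
    rw [this]
    refine tendsto_integral_of_dominated_convergence (fun z => 3 * dist z e)
      (fun n => (hsm n).aestronglyMeasurable) (hP.const_mul 3) ?_
      (Eventually.of_forall hs_lim)
    intro n
    exact Eventually.of_forall fun z => by
        rw [Real.norm_eq_abs, abs_of_nonneg dist_nonneg]; exact hsb n z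
  have hPs : ∀ n, Integrable (fun z => dist z e) (P.map (s n)) := by
    intro n
    have hm : Continuous (fun z : Z => dist z e) := by fun_prop
    rw [integrable_map_measure hm.measurable.aestronglyMeasurable (s n).measurable.aemeasurable]
    refine (hP.const_mul 2).mono' (hm.measurable.comp (s n).measurable).aestronglyMeasurable ?_
    exact Eventually.of_forall fun z => by
        rw [Real.norm_eq_abs, Function.comp, abs_of_nonneg dist_nonneg, dist_comm]
        exact hs_le n z
  have hAs : ∀ n, A (P.map (s n)).toSignedMeasure = ∫ z, a (s n z) ∂P := by
    intro n
    rw [rt_map_simple, rt_integral_simple, map_sum]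
    simp [ha]
  have hasi : ∀ n, Integrable (fun z => a (s n z)) P := by
    intro n
    exact ((SimpleFunc.map a (s n)).integrable_of_isFiniteMeasure)
  have b1 : ∀ n, ‖A P.toSignedMeasure - A (P.map (s n)).toSignedMeasure‖ ≤
      C * ∫ z, dist z (s n z) ∂P := by
    intro n
    haveI : IsFiniteMeasure (P.map (s n)) := inferInstance
    obtain ⟨h1, h2, -⟩ := rt_bounds (e := e) P (P.map (s n)) hP (hPs n)
      (k := ∫ z, dist z (s n z) ∂P) (by
        intro f _ hf
        have i2 := rt_lip_integrable (hPs n) hf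
        rw [integrable_map_measure hf.continuous.measurable.aestronglyMeasurable
          (s n).measurable.aemeasurable] at i2
        have i2 : Integrable (fun z => f (s n z)) P := i2
        rw [integral_map (s n).measurable.aemeasurable
          hf.continuous.measurable.aestronglyMeasurable,
          ← integral_sub (rt_lip_integrable hP hf) i2]
        exact integral_mono ((rt_lip_integrable hP hf).sub i2) (hsi n)
          (fun z => rt_lip_apply hf _ _))
    rw [← map_sub]
    refine (hC _ h1).trans ?_
    apply mul_le_mul_of_nonneg_left _ hC0
    refine h2.trans (le_of_eq ?_)
    rw [map_measureReal_apply (s n).measurable MeasurableSet.univ]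
    simp
  have b2 : ∀ n, ‖∫ z, a z ∂P - ∫ z, a (s n z) ∂P‖ ≤ C * ∫ z, dist z (s n z) ∂P := by
    intro n
    rw [← integral_sub hai (hasi n), ← integral_const_mul]
    apply norm_integral_le_of_norm_le ((hsi n).const_mul C)
    refine Eventually.of_forall fun z => ?_
    have h1 := hlip.dist_le_mul z (s n z)
    rw [dist_eq_norm, Real.coe_toNNReal _ hC0] at h1
    exact h1
  have b3 : ∀ n, ‖A P.toSignedMeasure - ∫ z, a z ∂P‖ ≤ 2 * C * ∫ z, dist z (s n z) ∂P := by
    intro n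
    have h1 := b1 n
    have h2 := b2 n
    rw [hAs n] at h1
    have h3 := norm_sub_le (A P.toSignedMeasure - ∫ z, a (s n z) ∂P)
      (∫ z, a z ∂P - ∫ z, a (s n z) ∂P)
    rw [sub_sub_sub_cancel_right] at h3
    linarith
  have b4 := ge_of_tendsto' (hlim.const_mul (2 * C)) b3
  rw [mul_zero] at b4
  exact sub_eq_zero.1 (norm_le_zero_iff.1 b4)

end OperatorPart
section ConePart

lemma rt_cone_aux [LocallyCompactSpace Z] [TopologicalSpace.SeparableSpace Z]
    {V : Type} [NormedAddCommGroup V] [NormedSpace ℝ V] [FiniteDimensional ℝ V]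
    {e : Z} {α β : ℝ} (hα : 0 < α) (a : Z → V) (haC : Continuous a)
    (C : PointedCone ℝ (V × ℝ))
    (hdip : ∀ z w, (a z - a w, α * dist z w + β * (1 + dist z e + (1 + dist w e))) ∈ C)
    (hmono : ∀ z, (a z, α * (1 + dist z e) + β * (1 + dist z e)) ∈ C)
    (P Q : Measure Z) [IsFiniteMeasure P] [IsFiniteMeasure Q]
    (hP : Integrable (fun z => dist z e) P) (hQ : Integrable (fun z => dist z e) Q)
    (haP : Integrable a P) (haQ : Integrable a Q) (K : ℝ)
    (hK : IsLUB {r | ∃ f : Z → ℝ, (f e = 0 ∧ LipschitzWith 1 f) ∧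
        r = ∫ z, f z ∂P - ∫ z, f z ∂Q} K)
    (hPQ : Q.real Set.univ ≤ P.real Set.univ) :
    ∃ t ≤ α * ((P.real Set.univ - Q.real Set.univ) + K) +
        β * (∫ z, (1 + dist z e) ∂P + ∫ z, (1 + dist z e) ∂Q),
      (∫ z, a z ∂P - ∫ z, a z ∂Q, t) ∈ C := by
  haveI : SecondCountableTopology Z := UniformSpace.secondCountable_of_separable Z
  haveI : CompleteSpace V := FiniteDimensional.complete ℝ V
  obtain ⟨s, hs⟩ : ∃ s : ℝ≥0, (s : ℝ) = P.real Set.univ - Q.real Set.univ :=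
    ⟨⟨_, sub_nonneg.2 hPQ⟩, rfl⟩
  set Q' : Measure Z := Q + s • Measure.dirac e with hQ'
  have hdir : ∀ {W : Type} [NormedAddCommGroup W] (h : Z → W),
      Integrable h (s • Measure.dirac e) := fun h =>
    (integrable_dirac (by simp)).smul_measure_nnreal
  have hadd : ∀ {W : Type} [NormedAddCommGroup W] {h : Z → W}, Integrable h Q →
      Integrable h Q' := fun hh => hh.add_measure (hdir _)
  have hint : ∀ {W : Type} [NormedAddCommGroup W] [NormedSpace ℝ W] [CompleteSpace W]
      {h : Z → W}, Integrable h Q →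
      ∫ z, h z ∂Q' = ∫ z, h z ∂Q + (s : ℝ) • h e := by
    intro W _ _ _ h hh
    rw [hQ', integral_add_measure hh (hdir _), integral_smul_nnreal_measure, integral_dirac]
    rfl
  have hQ'u : Q'.real Set.univ = P.real Set.univ := by
    rw [hQ', measureReal_add_apply, measureReal_nnreal_smul_apply]
    simp [hs]
  have hQ'e : Q'.real {e} = Q.real {e} + s := by
    rw [hQ', measureReal_add_apply, measureReal_nnreal_smul_apply]
    simp [measureReal_def]
  -- supremum over all 1-Lipschitz functions
  have hK' : IsLUB {r | ∃ g : Z → ℝ, LipschitzWith 1 g ∧ r = ∫ z, g z ∂P - ∫ z, g z ∂Q'} K := by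
    have : {r | ∃ g : Z → ℝ, LipschitzWith 1 g ∧ r = ∫ z, g z ∂P - ∫ z, g z ∂Q'} =
        {r | ∃ f : Z → ℝ, (f e = 0 ∧ LipschitzWith 1 f) ∧
        r = ∫ z, f z ∂P - ∫ z, f z ∂Q} := by
      ext r
      constructor
      · rintro ⟨g, hg, rfl⟩
        refine ⟨fun z => g z - g e, ⟨by simp, ?_⟩, ?_⟩
        · apply LipschitzWith.of_dist_le_mul
          intro x y
          simpa using hg.dist_le_mul x y
        · rw [hint (rt_lip_integrable hQ hg),
            integral_sub (rt_lip_integrable hP hg) (integrable_const _),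
            integral_sub (rt_lip_integrable hQ hg) (integrable_const _)]
          simp only [integral_const, smul_eq_mul, hs]
          ring
      · rintro ⟨f, ⟨hf0, hf⟩, rfl⟩
        refine ⟨f, hf, ?_⟩
        rw [hint (rt_lip_integrable hQ hf), hf0]
        simp
    rw [this]
    exact hK
  obtain ⟨π, hπfin, hπ1, hπ2, hπd, hπK⟩ := rt_plan e P Q' hP (hadd hQ) hQ'u.symm K hK'
  -- splitting weight
  obtain ⟨θ, hθ0, hθ1, hθ⟩ : ∃ θ : ℝ, 0 ≤ θ ∧ θ ≤ 1 ∧ θ * (Q.real {e} + s) = Q.real {e} := by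
    have hm : 0 ≤ Q.real {e} := measureReal_nonneg
    have hs0 : (0 : ℝ) ≤ s := s.2
    refine ⟨Q.real {e} / (Q.real {e} + s), by positivity,
      div_le_one_of_le₀ (by linarith) (by positivity), ?_⟩
    by_cases h : Q.real {e} + s = 0
    · rw [h]; linarith
    · exact div_mul_cancel₀ _ h
  let k : Z → ℝ := fun y => if y = e then θ else 1
  have hk0 : ∀ y, 0 ≤ k y := fun y => by simp only [k]; split_ifs <;> linarith
  have hk1 : ∀ y, k y ≤ 1 := fun y => by simp only [k]; split_ifs <;> linarith
  have hkh : ∀ {W : Type} [NormedAddCommGroup W] [NormedSpace ℝ W] (h : Z → W) (y : Z),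
      k y • h y = h y - ({e} : Set Z).indicator (fun _ => (1 - θ) • h e) y := by
    intro W _ _ h y
    by_cases hy : y = e
    · subst hy
      simp [k, sub_smul]
    · simp [k, hy]
  have hind : ∀ {W : Type} [NormedAddCommGroup W] (c : W),
      Integrable (({e} : Set Z).indicator (fun _ => c)) Q' := fun c =>
    (integrable_const c).indicator (measurableSet_singleton e)
  have hki : ∀ {W : Type} [NormedAddCommGroup W] [NormedSpace ℝ W] {h : Z → W},
      Integrable h Q → Integrable (fun y => k y • h y) Q' := by
    intro W _ _ h hh
    simp_rw [hkh]
    exact (hadd hh).sub (hind _)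
  have hkint : ∀ {W : Type} [NormedAddCommGroup W] [NormedSpace ℝ W] [CompleteSpace W]
      {h : Z → W}, Integrable h Q → ∫ y, k y • h y ∂Q' = ∫ y, h y ∂Q := by
    intro W _ _ _ h hh
    simp_rw [hkh]
    rw [integral_sub (hadd hh) (hind _), hint hh, integral_indicator (measurableSet_singleton e)]
    rw [setIntegral_const, hQ'e, smul_smul]
    have : (Q.real {e} + s) * (1 - θ) = s := by linarith
    rw [this]
    simp
  -- transfer to the plan
  have t1 : ∀ {W : Type} [NormedAddCommGroup W] [NormedSpace ℝ W] {h : Z → W},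
      Integrable h P → Integrable (fun z : Z × Z => h z.1) π ∧
        ∫ z, h z.1 ∂π = ∫ y, h y ∂P := by
    intro W _ _ h hh
    rw [← hπ1] at hh
    refine ⟨hh.comp_measurable measurable_fst, ?_⟩
    rw [← hπ1, integral_map measurable_fst.aemeasurable hh.aestronglyMeasurable]
  have t2 : ∀ {W : Type} [NormedAddCommGroup W] [NormedSpace ℝ W] {h : Z → W},
      Integrable h Q' → Integrable (fun z : Z × Z => h z.2) π ∧
        ∫ z, h z.2 ∂π = ∫ y, h y ∂Q' := by
    intro W _ _ h hh
    rw [← hπ2] at hh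
    refine ⟨hh.comp_measurable measurable_snd, ?_⟩
    rw [← hπ2, integral_map measurable_snd.aemeasurable hh.aestronglyMeasurable]
  have hdP : Integrable (fun z => 1 + dist z e) P := (integrable_const _).add hP
  have hdQ : Integrable (fun z => 1 + dist z e) Q := (integrable_const _).add hQ
  obtain ⟨ia1, ea1⟩ := t1 haP
  obtain ⟨ia2, ea2⟩ := t2 (hki haQ)
  rw [hkint haQ] at ea2
  obtain ⟨id1, ed1⟩ := t1 hdP
  obtain ⟨id2, ed2⟩ := t2 (hki hdQ)
  rw [hkint hdQ] at ed2
  obtain ⟨ik, ek⟩ := t2 (hki (integrable_const (1 : ℝ)))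
  rw [hkint (integrable_const (1 : ℝ))] at ek
  simp only [smul_eq_mul, mul_one, integral_const] at ik ek id2 ed2
  have hπu : π.real Set.univ = P.real Set.univ := by
    rw [← hπ1, map_measureReal_apply measurable_fst MeasurableSet.univ]
    simp
  let u : Z × Z → V := fun z => a z.1 - k z.2 • a z.2
  let v : Z × Z → ℝ := fun z => α * dist z.1 z.2 + α * (1 - k z.2) +
    β * (1 + dist z.1 e) + β * (k z.2 * (1 + dist z.2 e))
  have iu : Integrable u π := ia1.sub ia2
  have i1 : Integrable (fun z : Z × Z => α * dist z.1 z.2) π := hπd.const_mul α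
  have i2 : Integrable (fun z : Z × Z => α * (1 - k z.2)) π :=
    ((integrable_const _).sub ik).const_mul α
  have i3 : Integrable (fun z : Z × Z => β * (1 + dist z.1 e)) π := id1.const_mul β
  have i4 : Integrable (fun z : Z × Z => β * (k z.2 * (1 + dist z.2 e))) π := id2.const_mul β
  have i12 : Integrable (fun z : Z × Z => α * dist z.1 z.2 + α * (1 - k z.2)) π := i1.add i2
  have i123 : Integrable (fun z : Z × Z => α * dist z.1 z.2 + α * (1 - k z.2) +
    β * (1 + dist z.1 e)) π := i12.add i3
  have iv : Integrable v π := i123.add i4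
  have eu : ∫ z, u z ∂π = ∫ z, a z ∂P - ∫ z, a z ∂Q := by
    simp only [u]
    rw [integral_sub ia1 ia2, ea1, ea2]
  have ev : ∫ z, v z ∂π = α * ∫ z, dist z.1 z.2 ∂π + α * (P.real Set.univ - Q.real Set.univ) +
      β * ∫ z, (1 + dist z e) ∂P + β * ∫ z, (1 + dist z e) ∂Q := by
    simp only [v]
    rw [integral_add i123 i4, integral_add i12 i3, integral_add i1 i2,
      integral_const_mul, integral_const_mul, integral_const_mul, integral_const_mul,
      integral_sub (integrable_const _) ik, ek, ed1, ed2]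
    simp [hπu]
  refine ⟨∫ z, v z ∂π, ?_, ?_⟩
  · rw [ev]
    have := mul_le_mul_of_nonneg_left hπK hα.le
    linarith
  · rw [← eu, ← integral_pair iu iv]
    refine rt_mean_mem_cone π _ (V × ℝ) C _ rfl (iu.prodMk iv) (Eventually.of_forall fun z => ?_)
    have key : (u z, v z) = (⟨k z.2, hk0 _⟩ : ℝ≥0) • ((a z.1 - a z.2,
        α * dist z.1 z.2 + β * (1 + dist z.1 e + (1 + dist z.2 e))) : V × ℝ) +
        (⟨1 - k z.2, sub_nonneg.2 (hk1 _)⟩ : ℝ≥0) • ((a z.1,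
          α * (1 + dist z.1 e) + β * (1 + dist z.1 e)) : V × ℝ) := by
      apply Prod.ext
      · change a z.1 - k z.2 • a z.2 = k z.2 • (a z.1 - a z.2) + (1 - k z.2) • a z.1
        rw [smul_sub, sub_smul, one_smul]
        abel
      · change α * dist z.1 z.2 + α * (1 - k z.2) +
          β * (1 + dist z.1 e) + β * (k z.2 * (1 + dist z.2 e)) =
          k z.2 * (α * dist z.1 z.2 + β * (1 + dist z.1 e + (1 + dist z.2 e))) +
          (1 - k z.2) * (α * (1 + dist z.1 e) + β * (1 + dist z.1 e))
        by_cases h : z.2 = e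
        · rw [h]; simp; ring
        · simp only [k, h, if_false]; ring
    rw [key]
    exact C.add_mem (Submodule.smul_mem C _ (hdip _ _)) (Submodule.smul_mem C _ (hmono _))

lemma rt_cone [LocallyCompactSpace Z] [TopologicalSpace.SeparableSpace Z]
    {V : Type} [NormedAddCommGroup V] [NormedSpace ℝ V] [FiniteDimensional ℝ V]
    {e : Z} {α β : ℝ} (hα : 0 < α) (a : Z → V) (haC : Continuous a)
    (C : PointedCone ℝ (V × ℝ))
    (hdip : ∀ z w, (a z - a w, α * dist z w + β * (1 + dist z e + (1 + dist w e))) ∈ C)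
    (hmono : ∀ z, (a z, α * (1 + dist z e) + β * (1 + dist z e)) ∈ C)
    (hmono' : ∀ z, (- a z, α * (1 + dist z e) + β * (1 + dist z e)) ∈ C)
    (P Q : Measure Z) [IsFiniteMeasure P] [IsFiniteMeasure Q]
    (hP : Integrable (fun z => dist z e) P) (hQ : Integrable (fun z => dist z e) Q)
    (haP : Integrable a P) (haQ : Integrable a Q) (K : ℝ)
    (hK : IsLUB {r | ∃ f : Z → ℝ, (f e = 0 ∧ LipschitzWith 1 f) ∧
        r = ∫ z, f z ∂P - ∫ z, f z ∂Q} K) :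
    ∃ t ≤ α * (|P.real Set.univ - Q.real Set.univ| + K) +
        β * (∫ z, (1 + dist z e) ∂P + ∫ z, (1 + dist z e) ∂Q),
      (∫ z, a z ∂P - ∫ z, a z ∂Q, t) ∈ C := by
  rcases le_total (Q.real Set.univ) (P.real Set.univ) with h | h
  · rw [abs_of_nonneg (sub_nonneg.2 h)]
    exact rt_cone_aux hα a haC C hdip hmono P Q hP hQ haP haQ K hK h
  · rw [abs_of_nonpos (sub_nonpos.2 h)]
    have hset : {r | ∃ f : Z → ℝ, (f e = 0 ∧ LipschitzWith 1 f) ∧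
        r = ∫ z, f z ∂P - ∫ z, f z ∂Q} = {r | ∃ f : Z → ℝ, (f e = 0 ∧ LipschitzWith 1 f) ∧
        r = ∫ z, f z ∂Q - ∫ z, f z ∂P} := by
      ext r
      constructor
      · rintro ⟨f, ⟨hf0, hf⟩, rfl⟩
        refine ⟨fun z => - f z, ⟨by simp [hf0], hf.neg⟩, ?_⟩
        rw [integral_neg, integral_neg]; ring
      · rintro ⟨f, ⟨hf0, hf⟩, rfl⟩
        refine ⟨fun z => - f z, ⟨by simp [hf0], hf.neg⟩, ?_⟩
        rw [integral_neg, integral_neg]; ring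
    rw [hset] at hK
    obtain ⟨t, ht, hm⟩ := rt_cone_aux hα (fun z => - a z) haC.neg C (fun z w => by
      have := hdip w z
      rw [dist_comm w z, add_comm (1 + dist w e)] at this
      convert this using 2
      abel) hmono' Q P hQ hP haQ.neg haP.neg K hK h
    refine ⟨t, ?_, ?_⟩
    · linarith
    · rw [integral_neg, integral_neg, neg_sub_neg] at hm
      exact hm

end ConePart
section FinalPart

/-- Elementary signed measures: dipoles, and positive or negative monopoles. -/
def rtD : (Z × Z) ⊕ Z ⊕ Z → SignedMeasure Z
  | Sum.inl p => diracSM p.1 - diracSM p.2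
  | Sum.inr (Sum.inl z) => diracSM z
  | Sum.inr (Sum.inr z) => -diracSM z

/-- Cost of the elementary signed measures. -/
def rtCost (e : Z) (α β : ℝ) : (Z × Z) ⊕ Z ⊕ Z → ℝ
  | Sum.inl p => α * dist p.1 p.2 + β * (1 + dist p.1 e + (1 + dist p.2 e))
  | Sum.inr (Sum.inl z) => α * (1 + dist z e) + β * (1 + dist z e)
  | Sum.inr (Sum.inr z) => α * (1 + dist z e) + β * (1 + dist z e)

lemma rtCost_pos (e : Z) {α β : ℝ} (hα : 0 < α) (hβ : 0 < β) (i : (Z × Z) ⊕ Z ⊕ Z) :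
    0 < rtCost e α β i := by
  rcases i with p | z | z <;> simp only [rtCost] <;> positivity

lemma rtWit_D (e : Z) {α β : ℝ} (i : (Z × Z) ⊕ Z ⊕ Z) :
    rtWit e α β (rtD i) (rtCost e α β i) := by
  rcases i with p | z | z
  · exact rtWit.dipole _ _
  · exact rtWit.mono_pos _
  · exact rtWit.mono_neg _

lemma rtD_form (e : Z) (i : (Z × Z) ⊕ Z ⊕ Z) :
    ∃ (c : ℝ) (x : Z × Z) (m : ℝ),
      rtD i = c • (diracSM x.1 - diracSM x.2) + m • diracSM e := by
  rcases i with p | z | z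
  · exact ⟨1, p, 0, by simp [rtD]⟩
  · exact ⟨1, (z, e), 1, by simp [rtD]⟩
  · exact ⟨-1, (z, e), -1, by rw [← smul_add, sub_add_cancel, neg_one_smul]; rfl⟩

lemma rt_pad {ι X M : Type*} [AddCommGroup M] [Module ℝ M] (Φ : X → M) (x0 : X) (g : ι → ℝ)
    (d : ι → X) : ∀ (N : ℕ) (s : Finset ι), s.card ≤ N →
    ∃ (c : Fin N → ℝ) (x : Fin N → X), ∑ j, c j • Φ (x j) = ∑ i ∈ s, g i • Φ (d i) := by
  intro N
  induction N with
  | zero =>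
    intro s hs
    have : s = ∅ := Finset.card_eq_zero.1 (Nat.le_zero.1 hs)
    subst this
    exact ⟨fun _ => 0, fun _ => x0, by simp⟩
  | succ n ih =>
    intro s hs
    rcases s.eq_empty_or_nonempty with rfl | ⟨i, hi⟩
    · exact ⟨fun _ => 0, fun _ => x0, by simp⟩
    · obtain ⟨c, x, h⟩ := ih (s.erase i) (by rw [Finset.card_erase_of_mem hi]; omega)
      refine ⟨Fin.cons (g i) c, Fin.cons (d i) x, ?_⟩
      rw [Fin.sum_univ_succ]
      simp only [Fin.cons_zero, Fin.cons_succ]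
      rw [h, Finset.add_sum_erase s (fun i => g i • Φ (d i)) hi]

lemma rt_sum_apply {ι : Type*} (s : Finset ι) (m : ι → SignedMeasure Z) (B : Set Z) :
    (∑ i ∈ s, m i) B = ∑ i ∈ s, m i B := by
  have h2 := congrFun (map_sum (FunLike.coeAddMonoidHom (SignedMeasure Z) (Set Z) ℝ) m s) B
  rw [Finset.sum_apply] at h2
  exact h2

lemma rt_dirac_univ (x : Z) : diracSM x Set.univ = 1 := by
  rw [diracSM, Measure.toSignedMeasure_apply_measurable MeasurableSet.univ]
  simp

lemma rt_main [LocallyCompactSpace Z] [TopologicalSpace.SeparableSpace Z] {e : Z} {N : ℕ}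
    {α β : ℝ} (hα : 0 < α) (hβ : 0 < β)
    (A : SignedMeasure Z →ₗ[ℝ] EuclideanSpace ℝ (Fin N)) {C : ℝ} (hC0 : 0 ≤ C)
    (hC : ∀ μ : SignedMeasure Z, MemM1 e μ → ‖A μ‖ ≤ C * kruNorm e μ)
    {μ : SignedMeasure Z} (hμ : MemM1 e μ) :
    ∃ ν : SignedMeasure Z, A ν = A μ ∧ MemM1 e ν ∧
      α * kruNorm e ν + β * (momLint e 1 ν).toReal ≤
        α * kruNorm e μ + β * (momLint e 1 μ).toReal ∧
      ∃ (c : Fin N → ℝ) (z w : Fin N → Z),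
        ν = (∑ i, c i • (diracSM (z i) - diracSM (w i))) + ν Set.univ • diracSM e := by
  obtain ⟨hlip, hA⟩ := rt_A_integral A hC0 hC
  obtain ⟨P, Q, _, _, K, hPQ, hP, hQ, hK, hkru, hmom⟩ := rt_decomp hμ
  obtain ⟨haP, eP⟩ := hA P hP
  obtain ⟨haQ, eQ⟩ := hA Q hQ
  let G : (Z × Z) ⊕ Z ⊕ Z → EuclideanSpace ℝ (Fin N) × ℝ :=
    fun i => (A (rtD i), rtCost e α β i)
  let Cn : PointedCone ℝ (EuclideanSpace ℝ (Fin N) × ℝ) := Submodule.span _ (Set.range G)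
  have hG : ∀ i, G i ∈ Cn := fun i => Submodule.subset_span ⟨i, rfl⟩
  obtain ⟨t, ht, hmem⟩ := rt_cone (β := β) hα (fun z => A (diracSM z)) hlip.continuous Cn
    (fun z w => by
      have := hG (Sum.inl (z, w))
      simpa only [G, rtD, rtCost, map_sub] using this)
    (fun z => hG (Sum.inr (Sum.inl z)))
    (fun z => by
      have := hG (Sum.inr (Sum.inr z))
      simpa only [G, rtD, rtCost, map_neg] using this)
    P Q hP hQ haP haQ K hK
  rw [← hkru, ← hmom] at ht
  rw [← eP, ← eQ, ← map_sub, ← hPQ] at hmem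
  obtain ⟨cf, hcf⟩ := Finsupp.mem_span_range_iff_exists_finsupp.1 hmem
  rw [Finsupp.sum, Prod.ext_iff, Prod.fst_sum, Prod.snd_sum] at hcf
  obtain ⟨hc1, hc2⟩ := hcf
  obtain ⟨s, r, hcard, hr, hv, hcost⟩ := rt_reduce (fun i => A (rtD i)) (rtCost e α β)
    (rtCost_pos e hα hβ) _ cf.support (fun i => (cf i : ℝ)) rfl (fun i _ => (cf i).2)
  rw [finrank_euclideanSpace_fin] at hcard
  have hc1' : ∑ i ∈ cf.support, (cf i : ℝ) • A (rtD i) = A μ := hc1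
  have hc2' : ∑ i ∈ cf.support, (cf i : ℝ) * rtCost e α β i = t := hc2
  rw [hc1'] at hv
  rw [hc2'] at hcost
  have hwit : rtWit e α β (∑ i ∈ s, r i • rtD i) (∑ i ∈ s, r i * rtCost e α β i) := by
    clear hcard hv hcost
    induction s using Finset.induction_on with
    | empty => simpa using rtWit.zero
    | insert i s his ih =>
      rw [Finset.sum_insert his, Finset.sum_insert his]
      exact rtWit.add hα (rtWit.smul (hr i (Finset.mem_insert_self _ _)) (rtWit_D e i))
        (ih fun j hj => hr j (Finset.mem_insert_of_mem hj))
  obtain ⟨hb1, hb2⟩ := hwit.bound hα hβ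
  refine ⟨∑ i ∈ s, r i • rtD i, ?_, hb1, (hb2.trans hcost).trans ht, ?_⟩
  · rw [map_sum, ← hv]
    simp
  · choose c x m hcx using rtD_form (Z := Z) e
    obtain ⟨c', x', h'⟩ := rt_pad (fun p : Z × Z => diracSM p.1 - diracSM p.2) (e, e)
      (fun i => r i * c i) x N s hcard
    refine ⟨c', fun j => (x' j).1, fun j => (x' j).2, ?_⟩
    have h1 : ∑ i ∈ s, r i • rtD i =
        ∑ j, c' j • (diracSM (x' j).1 - diracSM (x' j).2) + (∑ i ∈ s, r i * m i) • diracSM e := by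
      rw [h', Finset.sum_smul, ← Finset.sum_add_distrib]
      refine Finset.sum_congr rfl fun i _ => ?_
      rw [hcx i, smul_add, smul_smul, smul_smul]
    have h2 : (∑ i ∈ s, r i • rtD i) Set.univ = ∑ i ∈ s, r i * m i := by
      rw [h1]
      change (∑ j, c' j • (diracSM (x' j).1 - diracSM (x' j).2)) Set.univ +
        (∑ i ∈ s, r i * m i) * diracSM e Set.univ = _
      rw [rt_sum_apply, rt_dirac_univ, mul_one, Finset.sum_eq_zero, zero_add]
      intro j _
      change c' j * (diracSM (x' j).1 Set.univ - diracSM (x' j).2 Set.univ) = 0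
      rw [rt_dirac_univ, rt_dirac_univ]
      ring
    rw [h2]
    exact h1

end FinalPart

/-- (Representer theorem for `p = 1`.)  Suppose `H = ℝ^N` and `p = 1`.
If the set of minimizers of `inf_{μ ∈ M_1(Z)} F(Aμ) + G_{α,β}(μ)` is non-empty and weak*
(sequentially) compact — with respect to the pairing of `M_1(Z) ⊂ Lip(Z)*` against Lipschitz
functions — then at least one minimizer is of the form
`μ_min = ∑_{i=1}^N c_i (δ_{z_i} − δ_{w_i}) + μ_min(Z) δ_e`. -/
theorem representer_theorem_p_one [LocallyCompactSpace Z] [CompleteSpace Z]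
    [TopologicalSpace.SeparableSpace Z] (hgeo : IsGeodesic Z) (e : Z)
    (α β : ℝ) (hα : 0 < α) (hβ : 0 < β) (N : ℕ)
    (A : SignedMeasure Z → EuclideanSpace ℝ (Fin N))
    (hAadd : ∀ μ ν : SignedMeasure Z, A (μ + ν) = A μ + A ν)
    (hAsmul : ∀ (c : ℝ) (μ : SignedMeasure Z), A (c • μ) = c • A μ)
    (hAbdd : ∃ C : ℝ, ∀ μ : SignedMeasure Z, MemM1 e μ → ‖A μ‖ ≤ C * kruNorm e μ)
    (F : EuclideanSpace ℝ (Fin N) → EReal)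
    (hFnebot : ∀ x, F x ≠ ⊥) (hFproper : ∃ x, F x ≠ ⊤)
    (hFconvex : ∀ x y : EuclideanSpace ℝ (Fin N), ∀ a b : ℝ, 0 ≤ a → 0 ≤ b → a + b = 1 →
      F (a • x + b • y) ≤ (a : EReal) * F x + (b : EReal) * F y)
    (hFcoercive : ∀ c : ℝ, ∃ R : ℝ, ∀ x : EuclideanSpace ℝ (Fin N),
      R ≤ ‖x‖ → (c : EReal) ≤ F x)
    (hFlsc : LowerSemicontinuous F)
    -- the set of minimizers over M_1(Z):
    (S : Set (SignedMeasure Z))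
    (hS : S = {μ : SignedMeasure Z | MemM1 e μ ∧ ∀ ν : SignedMeasure Z, MemM1 e ν →
      F (A μ) + ((α * kruNorm e μ + β * (momLint e 1 μ).toReal : ℝ) : EReal) ≤
      F (A ν) + ((α * kruNorm e ν + β * (momLint e 1 ν).toReal : ℝ) : EReal)})
    (hSne : S.Nonempty)
    (hScompact : ∀ μ : ℕ → SignedMeasure Z, (∀ n, μ n ∈ S) →
      ∃ (φ : ℕ → ℕ) (μlim : SignedMeasure Z), StrictMono φ ∧ μlim ∈ S ∧
        ∀ f : Z → ℝ, (∃ K : ℝ≥0, LipschitzWith K f) →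
          Tendsto (fun k => sInteg (μ (φ k)) f) atTop (nhds (sInteg μlim f))) :
    ∃ μmin ∈ S, ∃ (c : Fin N → ℝ) (z w : Fin N → Z),
      μmin = (∑ i, c i • (diracSM (z i) - diracSM (w i))) +
        μmin Set.univ • diracSM e := by
  obtain ⟨C, hC⟩ := hAbdd
  let A' : SignedMeasure Z →ₗ[ℝ] EuclideanSpace ℝ (Fin N) :=
    { toFun := A, map_add' := hAadd, map_smul' := hAsmul }
  have hkn : ∀ μ : SignedMeasure Z, MemM1 e μ → 0 ≤ kruNorm e μ := by
    intro μ hμ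
    obtain ⟨P, Q, _, _, K, -, -, -, hK, hkru, -⟩ := rt_decomp hμ
    have h0 : (0 : ℝ) ≤ K := hK.1 ⟨fun _ => 0, ⟨rfl, LipschitzWith.const' 0⟩, by simp⟩
    rw [hkru]
    positivity
  have hC' : ∀ μ : SignedMeasure Z, MemM1 e μ → ‖A' μ‖ ≤ |C| * kruNorm e μ := fun μ hμ =>
    (hC μ hμ).trans (mul_le_mul_of_nonneg_right (le_abs_self C) (hkn μ hμ))
  obtain ⟨μ, hμS⟩ := hSne
  have hμ := hμS
  rw [hS] at hμ
  obtain ⟨hμ1, hμ2⟩ := hμ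
  obtain ⟨ν, hν1, hν2, hν3, hν4⟩ := rt_main hα hβ A' (abs_nonneg C) hC' hμ1
  have hAν : A ν = A μ := hν1
  refine ⟨ν, ?_, hν4⟩
  rw [hS]
  refine ⟨hν2, fun ξ hξ => le_trans ?_ (hμ2 ξ hξ)⟩
  rw [hAν]
  exact add_le_add le_rfl (EReal.coe_le_coe_iff.2 hν3)
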